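/- Assume BH(s,r) holds for some 3/2 < s < 2 and r < s', and let Ω, K, J, ε be as follows: Ω ⊆ [0,1]² measurable with every nonempty vertical fiber of Ω of 𝓗¹-measure in [2^{-K-1}, 2^{-K+1}], with 2^{-J-1} ≤ |π₁(Ω)| ≤ 2^{-J+1}, and ε ≲ 1 the smallest dyadic number such that ∥𝓔χ_{Ω'}∥_{L^{2s}} ≤ ε|Ω|^{1/s'} for all measurable Ω' ⊆ Ω. Let C > 0 be a sufficiently large admissible constant and define, for S = π₁(Ω) and dyadic 0 < η ≤ ε: I_η(ξ₁) is the maximal dyadic interval I containing ξ₁ with |I ∩ S| ≥ η^C |I| (when it exists), T_η = {ξ₁ ∈ S : |I_η(ξ₁)| ≥ η^C 2^{-J}}, S_ε = T_ε and S_η = T_η \ T_{2η} for η < ε, and Ω¹_η = Ω ∩ π₁^{-1}(S_η). Then: (i) each S_η is contained in a union of O(η^{-2C}) dyadic intervals of length 2^{-J}; and (ii) for each dyadic η < ε and each measurable Ω' ⊆ Ω¹_η, ∥𝓔χ_{Ω'}∥_{L^{2s}} ≲ η² |Ω|^{1/s'}. -/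

import Mathlib

open MeasureTheory Set
open scoped ENNReal

/-- The extension operator for the hyperbolic paraboloid `τ = ξ₁ξ₂` in `ℝ³`:
`𝓔f(t,x) = ∫_{ℝ²} e^{i(tξ₁ξ₂ + x·ξ)} f(ξ) dξ`. -/
noncomputable def extOp (f : ℝ × ℝ → ℂ) (p : ℝ × ℝ × ℝ) : ℂ :=
  ∫ ξ : ℝ × ℝ,
    Complex.exp (Complex.I * (p.1 * ξ.1 * ξ.2 + p.2.1 * ξ.1 + p.2.2 * ξ.2 : ℝ)) * f ξ

/-- Characteristic function of a set, valued in `ℂ`. -/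
noncomputable def chi (Ω : Set (ℝ × ℝ)) : ℝ × ℝ → ℂ := Ω.indicator fun _ => 1

/-- The axis-parallel unit square with lower-left corner `(a, b)`. -/
def unitSq (a b : ℝ) : Set (ℝ × ℝ) := Icc a (a + 1) ×ˢ Icc b (b + 1)

/-- Bilinear hypothesis BH(s,r) with constant `A`: a bilinear adjoint restriction estimate
`∥𝓔f·𝓔g∥_{L^s} ≤ A ∥f∥_{L^r} ∥g∥_{L^r}` whenever `f, g` are supported in `1 × 1`
axis-parallel squares whose projections onto each coordinate axis are separated by a
distance between `1` and `4` (equivalently, the corners satisfy `2 ≤ |aᵢ - bᵢ| ≤ 5`). -/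
def BH (s r A : ℝ) : Prop :=
  ∀ a₁ a₂ b₁ b₂ : ℝ, 2 ≤ |a₁ - b₁| → |a₁ - b₁| ≤ 5 → 2 ≤ |a₂ - b₂| → |a₂ - b₂| ≤ 5 →
    ∀ f g : ℝ × ℝ → ℂ,
      Function.support f ⊆ unitSq a₁ a₂ → Function.support g ⊆ unitSq b₁ b₂ →
      eLpNorm (fun p => extOp f p * extOp g p) (ENNReal.ofReal s) volume ≤
        ENNReal.ofReal A * eLpNorm f (ENNReal.ofReal r) volume *
          eLpNorm g (ENNReal.ofReal r) volume


/-- The dyadic interval `[m·2⁻ⁿ, (m+1)·2⁻ⁿ]`. -/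
def dyadicIcc (n m : ℤ) : Set ℝ := Icc ((m : ℝ) * 2 ^ (-n)) (((m : ℝ) + 1) * 2 ^ (-n))

/-- A tile in `𝓓_{j,k}`: a product of a dyadic interval of length `2⁻ʲ` with one of
length `2⁻ᵏ`. -/
def tile (j k m m' : ℤ) : Set (ℝ × ℝ) := dyadicIcc j m ×ˢ dyadicIcc k m'

/-- A dyadic number is one of the form `2ⁿ`, `n ∈ ℤ`. -/
def IsDyadic (x : ℝ) : Prop := ∃ n : ℤ, x = 2 ^ n

/-- The vertical fiber of `Ω ⊆ ℝ²` over `x`: `{η : (x, η) ∈ Ω}`. -/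
def vFiber (Ω : Set (ℝ × ℝ)) (x : ℝ) : Set ℝ := {y | (x, y) ∈ Ω}

/-- `Ω(K) = {ξ ∈ Ω : 2^{-K-1} ≤ 𝓗¹({η : (ξ₁,η) ∈ Ω}) ≤ 2^{-K+1}}`, the piece of `Ω` whose
vertical fibers have length about `2⁻ᴷ`. -/
noncomputable def fiberPiece (Ω : Set (ℝ × ℝ)) (K : ℕ) : Set (ℝ × ℝ) :=
  {ξ ∈ Ω | (2 : ℝ≥0∞) ^ (-(K : ℤ) - 1) ≤ volume (vFiber Ω ξ.1) ∧
    volume (vFiber Ω ξ.1) ≤ (2 : ℝ≥0∞) ^ (-(K : ℤ) + 1)}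

/-- `VargasBound s Ω c` says `∥𝓔χ_{Ω'}∥_{L^{2s}} ≤ c·|Ω|^{1/s'}` for every measurable
`Ω' ⊆ Ω` (here `1/s' = 1 - 1/s`). -/
def VargasBound (s : ℝ) (Ω : Set (ℝ × ℝ)) (c : ℝ) : Prop :=
  ∀ Ω' ⊆ Ω, MeasurableSet Ω' →
    eLpNorm (extOp (chi Ω')) (ENNReal.ofReal (2 * s)) volume ≤
      ENNReal.ofReal c * volume Ω ^ (1 - 1 / s)

/-- `Tset S C J η` is the set `T_η`: points `ξ₁ ∈ S` for which there is a dyadic interval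
`I ∋ ξ₁` with `|I| ≥ η^C 2^{-J}` and `|I ∩ S| ≥ η^C |I|`; equivalently, the maximal dyadic
interval `I_η(ξ₁) ∋ ξ₁` with `|I_η(ξ₁) ∩ S| ≥ η^C |I_η(ξ₁)|` satisfies
`|I_η(ξ₁)| ≥ η^C 2^{-J}`. -/
noncomputable def Tset (S : Set ℝ) (C : ℝ) (J : ℕ) (η : ℝ) : Set ℝ :=
  {x ∈ S | ∃ n m : ℤ, x ∈ dyadicIcc n m ∧ η ^ C * (2 : ℝ) ^ (-(J : ℤ)) ≤ (2 : ℝ) ^ (-n) ∧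
    ENNReal.ofReal (η ^ C * (2 : ℝ) ^ (-n)) ≤ volume (dyadicIcc n m ∩ S)}

/-- `Sset S C J ε η` is the set `S_η`: `S_η = T_η \ T_{2η}` for `η < ε`, and `S_ε = T_ε`. -/
noncomputable def Sset (S : Set ℝ) (C : ℝ) (J : ℕ) (ε η : ℝ) : Set ℝ :=
  if η < ε then Tset S C J η \ Tset S C J (2 * η) else Tset S C J η

lemma exists_kernel : ∃ φ : ℝ → ℂ, Continuous φ ∧ (∃ K : ℝ, 0 < K ∧ ∀ v, ‖φ v‖ ≤ K / (1 + v ^ 2)) ∧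
    ∀ w : ℝ, |w| ≤ 1 → ∫ v, φ v * Complex.exp (Complex.I * (w * v : ℝ)) = 1 := by
  let f : ContDiffBump (0 : ℝ) := ⟨1, 2, by norm_num, by norm_num⟩
  have hc : HasCompactSupport (fun x : ℝ => ((f x : ℝ) : ℂ)) :=
    f.hasCompactSupport.comp_left (g := fun x : ℝ => (x : ℂ)) (by simp)
  have hd : ContDiff ℝ ((⊤ : ℕ∞) : WithTop ℕ∞) (fun x : ℝ => ((f x : ℝ) : ℂ)) :=
    Complex.ofRealCLM.contDiff.comp f.contDiff
  let ψ : SchwartzMap ℝ ℂ := hc.toSchwartzMap hd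
  have hψ : ∀ x, ψ x = ((f x : ℝ) : ℂ) := fun x => rfl
  let φ : SchwartzMap ℝ ℂ := FourierTransformInv.fourierInv ψ
  have hφ : FourierTransform.fourier φ = ψ := FourierTransform.fourier_fourierInv_eq ψ
  refine ⟨φ, φ.continuous, ?_, ?_⟩
  · obtain ⟨C0, h0, h0'⟩ := φ.decay 0 0
    obtain ⟨C2, h2, h2'⟩ := φ.decay 2 0
    refine ⟨C0 + C2, by positivity, fun v => ?_⟩
    have a0 := h0' v
    have a2 := h2' v
    simp at a0 a2
    rw [le_div_iff₀ (by positivity)]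
    nlinarith
  · intro w hw
    have h1 : (FourierTransform.fourier φ) (-w / (2 * Real.pi)) = 1 := by
      rw [hφ, hψ, f.one_of_mem_closedBall]
      · simp
      · simp only [mem_closedBall_iff_norm, sub_zero, Real.norm_eq_abs]
        change _ ≤ (1 : ℝ)
        rw [abs_div, abs_neg, abs_of_pos (by positivity : 0 < 2 * Real.pi), div_le_one (by positivity)]
        nlinarith [Real.pi_gt_three]
    rw [SchwartzMap.fourier_coe, Real.fourier_eq'] at h1
    rw [← h1]
    congr 1
    ext v
    rw [smul_eq_mul, mul_comm]
    congr 2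
    simp only [RCLike.inner_apply, conj_trivial]
    push_cast
    have : (Real.pi : ℂ) ≠ 0 := by exact_mod_cast Real.pi_ne_zero
    field_simp

lemma period_L2 (a : ℤ → ℂ) (A : Finset ℤ) (α : ℝ) :
    ∫⁻ v in Ioc α (α + Real.pi), ‖∑ m ∈ A, a m * Complex.exp (Complex.I * (2 * m * v : ℝ))‖ₑ ^ 2
      = ENNReal.ofReal Real.pi * ∑ m ∈ A, ‖a m‖ₑ ^ 2 := by
  have key : ∀ k : ℤ, ∫ v in α..(α + Real.pi), Complex.exp (Complex.I * (2 * k * v : ℝ))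
      = if k = 0 then (Real.pi : ℂ) else 0 := by
    intro k
    split_ifs with h
    · simp [h]
    · have h2 : (2 * k * Complex.I : ℂ) ≠ 0 := by
        simp [h]
      have := integral_exp_mul_complex (a := α) (b := α + Real.pi) h2
      have e : ∀ v : ℝ, Complex.I * (2 * k * v : ℝ) = 2 * k * Complex.I * v := by
        intro v; push_cast; ring
      simp_rw [e]
      rw [this]
      have : Complex.exp (2 * k * Complex.I * ((α + Real.pi : ℝ) : ℂ)) = Complex.exp (2 * k * Complex.I * α) := by
        rw [Complex.exp_eq_exp_iff_exists_int]
        refine ⟨k, ?_⟩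
        push_cast; ring
      rw [this]; simp
  have hpt : ∀ v : ℝ, ((‖∑ m ∈ A, a m * Complex.exp (Complex.I * (2 * m * v : ℝ))‖ ^ 2 : ℝ) : ℂ)
      = ∑ m ∈ A, ∑ n ∈ A, a m * (starRingEnd ℂ) (a n) * Complex.exp (Complex.I * (2 * (m - n : ℤ) * v : ℝ)) := by
    intro v
    rw [Complex.ofReal_pow, ← Complex.mul_conj', map_sum, Finset.sum_mul_sum]
    refine Finset.sum_congr rfl fun m _ => Finset.sum_congr rfl fun n _ => ?_
    rw [map_mul, ← Complex.exp_conj]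
    have : Complex.exp (Complex.I * (2 * (m - n : ℤ) * v : ℝ)) = 
        Complex.exp (Complex.I * (2 * m * v : ℝ)) * Complex.exp ((starRingEnd ℂ) (Complex.I * (2 * n * v : ℝ))) := by
      rw [← Complex.exp_add]
      congr 1
      simp only [map_mul, Complex.conj_I, Complex.conj_ofReal]
      push_cast; ring
    rw [this]; ring
  have hcont : Continuous fun v : ℝ => ‖∑ m ∈ A, a m * Complex.exp (Complex.I * (2 * m * v : ℝ))‖ ^ 2 := by
    fun_prop
  have h_integ : ∫ v in α..(α + Real.pi), ‖∑ m ∈ A, a m * Complex.exp (Complex.I * (2 * m * v : ℝ))‖ ^ 2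
      = Real.pi * ∑ m ∈ A, ‖a m‖ ^ 2 := by
    have : ((∫ v in α..(α + Real.pi), ‖∑ m ∈ A, a m * Complex.exp (Complex.I * (2 * m * v : ℝ))‖ ^ 2 : ℝ) : ℂ)
      = ((Real.pi * ∑ m ∈ A, ‖a m‖ ^ 2 : ℝ) : ℂ) := by
      rw [← intervalIntegral.integral_ofReal]
      simp_rw [hpt]
      rw [intervalIntegral.integral_finsetSum]
      · rw [Complex.ofReal_mul, Complex.ofReal_sum, Finset.mul_sum]
        refine Finset.sum_congr rfl fun m hm => ?_
        rw [intervalIntegral.integral_finsetSum]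
        · simp_rw [intervalIntegral.integral_const_mul, key, sub_eq_zero]
          simp only [mul_ite, mul_zero, Finset.sum_ite_eq, hm, if_true]
          rw [Complex.mul_conj']
          push_cast; ring
        · intro n _; apply Continuous.intervalIntegrable; fun_prop
      · intro n _; apply Continuous.intervalIntegrable; fun_prop
    exact_mod_cast this
  have e1 : ∀ v : ℝ, ‖∑ m ∈ A, a m * Complex.exp (Complex.I * (2 * m * v : ℝ))‖ₑ ^ 2 = 
     ENNReal.ofReal (‖∑ m ∈ A, a m * Complex.exp (Complex.I * (2 * m * v : ℝ))‖ ^ 2) := by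
    intro v; rw [ENNReal.ofReal_pow (norm_nonneg _), ofReal_norm]
  simp_rw [e1]
  rw [← ofReal_integral_eq_lintegral_ofReal, ← intervalIntegral.integral_of_le (by linarith [Real.pi_pos]), h_integ,
    ENNReal.ofReal_mul Real.pi_pos.le, ENNReal.ofReal_sum_of_nonneg (fun _ _ => by positivity)]
  · congr 1
    refine Finset.sum_congr rfl fun m _ => ?_
    rw [ENNReal.ofReal_pow (norm_nonneg _), ofReal_norm]
  · exact (hcont.integrableOn_Icc (a := α) (b := α + Real.pi)).mono_set Ioc_subset_Icc_self
  · exact Filter.Eventually.of_forall fun v => by positivity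

lemma weighted_L2 (φ : ℝ → ℂ) (K : ℝ) (hK : 0 < K) (hφ : ∀ v, ‖φ v‖ ≤ K / (1 + v ^ 2)) :
    ∃ D : ℝ≥0∞, D ≠ ∞ ∧ ∀ (a : ℤ → ℂ) (A : Finset ℤ),
    ∫⁻ v, ‖φ v‖ₑ * ‖∑ m ∈ A, a m * Complex.exp (Complex.I * (2 * m * v : ℝ))‖ₑ ^ 2
      ≤ D * ∑ m ∈ A, ‖a m‖ₑ ^ 2 := by
  let c : ℤ → ℝ≥0∞ := fun l => ENNReal.ofReal (4 * K / (1 + (l : ℝ) ^ 2))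
  have hsum : Summable fun l : ℤ => 4 * K / (1 + (l : ℝ) ^ 2) := by
    have h := (Real.summable_one_div_int_pow (p := 2)).2 (by norm_num)
    have h' : Summable fun l : ℤ => 4 * K * (1 / (l : ℝ) ^ 2) + if l = 0 then 4 * K else 0 :=
      (h.mul_left (4 * K)).add (summable_of_ne_finset_zero (s := {0}) (by intro b hb; simp at hb; simp [hb]))
    refine Summable.of_nonneg_of_le (fun l => by positivity) (fun l => ?_) h'
    by_cases hl : l = 0
    · simp [hl]
    · have : (0 : ℝ) < (l : ℝ) ^ 2 := by positivity
      simp only [hl, if_false, add_zero, mul_one_div]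
      gcongr
      linarith
  refine ⟨(∑' l, c l) * ENNReal.ofReal Real.pi, ENNReal.mul_ne_top ?_ ENNReal.ofReal_ne_top, fun a A => ?_⟩
  · simp only [c]
    rw [← ENNReal.ofReal_tsum_of_nonneg (fun l => by positivity) hsum]
    exact ENNReal.ofReal_ne_top
  rw [← setLIntegral_univ, ← iUnion_Ioc_zsmul Real.pi_pos, lintegral_iUnion (fun _ => measurableSet_Ioc)
    (pairwise_disjoint_Ioc_zsmul Real.pi), mul_assoc, ← ENNReal.tsum_mul_right]
  refine ENNReal.tsum_le_tsum fun l => ?_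
  have hE : (l + 1) • Real.pi = l • Real.pi + Real.pi := by rw [add_smul, one_smul]
  rw [hE, ← period_L2 a A (l • Real.pi), ← lintegral_const_mul]
  · refine setLIntegral_mono' measurableSet_Ioc fun v hv => ?_
    gcongr
    rw [← ofReal_norm]
    apply ENNReal.ofReal_le_ofReal
    refine (hφ v).trans ?_
    rw [div_le_div_iff₀ (by positivity) (by positivity)]
    simp only [zsmul_eq_mul, mem_Ioc] at hv
    have hp := Real.pi_gt_three
    have : (1 + (l : ℝ) ^ 2) ≤ 4 * (1 + v ^ 2) := by
      rcases le_or_gt 0 l with h | h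
      · have h' : (0 : ℝ) ≤ l := by exact_mod_cast h
        have h2 : (l : ℝ) ≤ v := by nlinarith
        nlinarith [pow_le_pow_left₀ h' h2 2]
      · have h' : (l : ℝ) + 1 ≤ 0 := by exact_mod_cast h
        have : v ≤ l + 1 := by nlinarith
        nlinarith [sq_nonneg ((l : ℝ) + 4 / 3), mul_nonneg (by linarith : 0 ≤ ((l : ℝ) + 1) - v) (by linarith : 0 ≤ -v - ((l : ℝ) + 1))]
    nlinarith
  · have : Continuous fun v : ℝ => ∑ m ∈ A, a m * Complex.exp (Complex.I * (2 * m * v : ℝ)) := by fun_prop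
    exact (this.measurable.enorm).pow_const 2

/-- lattice character -/
noncomputable def chr (q : ℤ × ℤ) (v : ℝ × ℝ) : ℂ :=
  Complex.exp (Complex.I * (2 * q.1 * v.1 + 2 * q.2 * v.2 : ℝ))

lemma chr_cont (q : ℤ × ℤ) : Continuous (chr q) := by
  unfold chr; fun_prop

lemma sum_rpow_le_one (p : ℝ) (hp0 : 0 < p) (hp : p ≤ 1) {ι : Type*} (A : Finset ι) (x : ι → ℝ≥0∞) :
    (∑ i ∈ A, x i) ^ p ≤ ∑ i ∈ A, x i ^ p := by
  classical
  induction A using Finset.induction_on with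
  | empty => simp [hp0]
  | insert a A ha ih =>
    rw [Finset.sum_insert ha, Finset.sum_insert ha]
    exact (ENNReal.rpow_add_le_add_rpow _ _ hp0.le hp).trans (by gcongr)

lemma two_dim_L2 (ν : Measure ℝ) [IsFiniteMeasure ν] (D : ℝ≥0∞)
    (hD : ∀ (a : ℤ → ℂ) (A : Finset ℤ),
      ∫⁻ v, ‖∑ m ∈ A, a m * Complex.exp (Complex.I * (2 * m * v : ℝ))‖ₑ ^ 2 ∂ν
      ≤ D * ∑ m ∈ A, ‖a m‖ₑ ^ 2) (a : ℤ × ℤ → ℂ) (A A' : Finset ℤ) :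
    ∫⁻ v, ‖∑ q ∈ A ×ˢ A', a q * chr q v‖ₑ ^ 2 ∂(ν.prod ν) ≤ D * D * ∑ q ∈ A ×ˢ A', ‖a q‖ₑ ^ 2 := by
  have hc : Continuous fun v : ℝ × ℝ => ∑ q ∈ A ×ˢ A', a q * chr q v := by
    have := chr_cont; fun_prop
  rw [lintegral_prod_symm' _ (hc.measurable.enorm.pow_const 2)]
  have h1 : ∀ y : ℝ, ∫⁻ x, ‖∑ q ∈ A ×ˢ A', a q * chr q (x, y)‖ₑ ^ 2 ∂ν ≤ 
      D * ∑ m ∈ A, ‖∑ n ∈ A', a (m, n) * Complex.exp (Complex.I * (2 * n * y : ℝ))‖ₑ ^ 2 := by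
    intro y
    refine le_trans (le_of_eq ?_) (hD _ A)
    congr 1; ext x; congr 2
    rw [Finset.sum_product]
    refine Finset.sum_congr rfl fun m _ => ?_
    rw [Finset.sum_mul]
    refine Finset.sum_congr rfl fun n _ => ?_
    rw [mul_assoc, ← Complex.exp_add, chr]
    congr 2
    push_cast; ring
  refine (lintegral_mono h1).trans ?_
  have hm : ∀ m, Measurable fun y : ℝ => ‖∑ n ∈ A', a (m, n) * Complex.exp (Complex.I * (2 * n * y : ℝ))‖ₑ ^ 2 := by
    intro m
    have : Continuous fun y : ℝ => ∑ n ∈ A', a (m, n) * Complex.exp (Complex.I * (2 * n * y : ℝ)) := by fun_prop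
    exact this.measurable.enorm.pow_const 2
  rw [lintegral_const_mul _ (Finset.measurable_fun_sum _ fun m _ => hm m), mul_assoc]
  gcongr
  rw [lintegral_finsetSum _ fun m _ => hm m, Finset.sum_product, Finset.mul_sum]
  gcongr with m hm
  exact hD _ _

lemma enorm_rpow_bound {α : Type*} [MeasurableSpace α] (μ : Measure α) (f : α → ℂ) (hf : AEStronglyMeasurable f μ)
    (p q : ℝ) (hp : 0 < p) (hpq : p ≤ q) :
    ∫⁻ x, ‖f x‖ₑ ^ p ∂μ ≤ (∫⁻ x, ‖f x‖ₑ ^ q ∂μ) ^ (p / q) * μ univ ^ (1 - p / q) := by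
  have h := eLpNorm'_le_eLpNorm'_mul_rpow_measure_univ hp hpq hf
  rw [eLpNorm'_eq_lintegral_enorm, eLpNorm'_eq_lintegral_enorm] at h
  have h2 := ENNReal.rpow_le_rpow h hp.le
  rw [← ENNReal.rpow_mul, ENNReal.mul_rpow_of_nonneg _ _ hp.le, ← ENNReal.rpow_mul, ← ENNReal.rpow_mul] at h2
  have e1 : 1 / p * p = 1 := by field_simp
  have e2 : 1 / q * p = p / q := by ring
  have e3 : (1 / p - 1 / q) * p = 1 - p / q := by field_simp
  rwa [e1, e2, e3, ENNReal.rpow_one] at h2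

lemma AO (ν : Measure ℝ) [IsFiniteMeasure ν] (D : ℝ≥0∞) (hDt : D ≠ ∞)
    (hD : ∀ (a : ℤ → ℂ) (A : Finset ℤ),
      ∫⁻ v, ‖∑ m ∈ A, a m * Complex.exp (Complex.I * (2 * m * v : ℝ))‖ₑ ^ 2 ∂ν
      ≤ D * ∑ m ∈ A, ‖a m‖ₑ ^ 2) (s : ℝ) (hs1 : 1 ≤ s) (hs2 : s ≤ 2) :
    ∃ C : ℝ≥0∞, C ≠ ∞ ∧ ∀ (F : ℤ × ℤ → ℝ × ℝ → ℂ) (A A' : Finset ℤ), (∀ q, Continuous (F q)) →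
      (∀ x, ‖∑ q ∈ A ×ˢ A', F q x‖ₑ ≤ ∫⁻ v, ‖∑ q ∈ A ×ˢ A', F q (x - v) * chr q v‖ₑ ∂(ν.prod ν)) →
      ∫⁻ x, ‖∑ q ∈ A ×ˢ A', F q x‖ₑ ^ s ≤ C * ∑ q ∈ A ×ˢ A', ∫⁻ x, ‖F q x‖ₑ ^ s := by
  set N := (ν.prod ν) univ with hN
  have hNt : N ≠ ∞ := measure_ne_top _ _
  have hs0 : 0 < s := by linarith
  refine ⟨N ^ (s - 1) * (N ^ (1 - s / 2) * (D * D) ^ (s / 2)), ?_, ?_⟩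
  · refine ENNReal.mul_ne_top (ENNReal.rpow_ne_top_of_nonneg (by linarith) hNt)
      (ENNReal.mul_ne_top (ENNReal.rpow_ne_top_of_nonneg (by linarith) hNt)
        (ENNReal.rpow_ne_top_of_nonneg (by linarith) (ENNReal.mul_ne_top hDt hDt)))
  intro F A A' hF hrep
  have hchr := chr_cont
  have hcH : Continuous fun z : (ℝ × ℝ) × (ℝ × ℝ) => ∑ q ∈ A ×ˢ A', F q (z.1 - z.2) * chr q z.2 := by
    fun_prop
  have hcG : Continuous fun z : (ℝ × ℝ) × (ℝ × ℝ) => ∑ q ∈ A ×ˢ A', F q z.1 * chr q z.2 := by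
    fun_prop
  have step1 : ∀ x, ‖∑ q ∈ A ×ˢ A', F q x‖ₑ ^ s ≤ 
      N ^ (s - 1) * ∫⁻ v, ‖∑ q ∈ A ×ˢ A', F q (x - v) * chr q v‖ₑ ^ s ∂(ν.prod ν) := by
    intro x
    have h1 := enorm_rpow_bound (ν.prod ν) (fun v => ∑ q ∈ A ×ˢ A', F q (x - v) * chr q v)
      (by have : Continuous fun v => ∑ q ∈ A ×ˢ A', F q (x - v) * chr q v := by fun_prop
          exact this.aestronglyMeasurable) 1 s one_pos hs1
    simp only [ENNReal.rpow_one] at h1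
    have h2 := ENNReal.rpow_le_rpow ((hrep x).trans h1) hs0.le
    rw [ENNReal.mul_rpow_of_nonneg _ _ hs0.le, ← ENNReal.rpow_mul, ← ENNReal.rpow_mul] at h2
    have e1 : 1 / s * s = 1 := by field_simp
    have e2 : (1 - 1 / s) * s = s - 1 := by field_simp
    rw [e1, e2, ENNReal.rpow_one] at h2
    rwa [mul_comm]
  have step2 : ∀ u, ∫⁻ v, ‖∑ q ∈ A ×ˢ A', F q u * chr q v‖ₑ ^ s ∂(ν.prod ν) ≤ 
      (N ^ (1 - s / 2) * (D * D) ^ (s / 2)) * ∑ q ∈ A ×ˢ A', ‖F q u‖ₑ ^ s := by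
    intro u
    have h1 := enorm_rpow_bound (ν.prod ν) (fun v => ∑ q ∈ A ×ˢ A', F q u * chr q v)
      (by have : Continuous fun v => ∑ q ∈ A ×ˢ A', F q u * chr q v := by fun_prop
          exact this.aestronglyMeasurable) s 2 hs0 hs2
    refine h1.trans ?_
    rw [mul_comm, mul_assoc]
    gcongr
    have h2 := two_dim_L2 ν D hD (fun q => F q u) A A'
    have h3 := ENNReal.rpow_le_rpow h2 (by linarith : 0 ≤ s / 2)
    rw [ENNReal.mul_rpow_of_nonneg _ _ (by linarith)] at h3
    simp only [ENNReal.rpow_ofNat]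
    refine h3.trans ?_
    gcongr
    refine (sum_rpow_le_one (s / 2) (by linarith) (by linarith) _ _).trans (le_of_eq ?_)
    refine Finset.sum_congr rfl fun q _ => ?_
    rw [← ENNReal.rpow_natCast, ← ENNReal.rpow_mul]
    congr 1; push_cast; ring
  calc ∫⁻ x, ‖∑ q ∈ A ×ˢ A', F q x‖ₑ ^ s 
      ≤ ∫⁻ x, N ^ (s - 1) * ∫⁻ v, ‖∑ q ∈ A ×ˢ A', F q (x - v) * chr q v‖ₑ ^ s ∂(ν.prod ν) := lintegral_mono step1
    _ = N ^ (s - 1) * ∫⁻ x, ∫⁻ v, ‖∑ q ∈ A ×ˢ A', F q (x - v) * chr q v‖ₑ ^ s ∂(ν.prod ν) := by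
        rw [lintegral_const_mul']
        exact ENNReal.rpow_ne_top_of_nonneg (by linarith) hNt
    _ = N ^ (s - 1) * ∫⁻ v, ∫⁻ x, ‖∑ q ∈ A ×ˢ A', F q (x - v) * chr q v‖ₑ ^ s ∂volume ∂(ν.prod ν) := by
        rw [lintegral_lintegral_swap]
        exact (hcH.measurable.enorm.pow_const s).aemeasurable
    _ = N ^ (s - 1) * ∫⁻ v, ∫⁻ u, ‖∑ q ∈ A ×ˢ A', F q u * chr q v‖ₑ ^ s ∂volume ∂(ν.prod ν) := by
        congr 1
        refine lintegral_congr fun v => ?_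
        exact lintegral_sub_right_eq_self (fun u => ‖∑ q ∈ A ×ˢ A', F q u * chr q v‖ₑ ^ s) v
    _ = N ^ (s - 1) * ∫⁻ u, ∫⁻ v, ‖∑ q ∈ A ×ˢ A', F q u * chr q v‖ₑ ^ s ∂(ν.prod ν) ∂volume := by
        rw [lintegral_lintegral_swap]
        exact ((hcG.comp continuous_swap).measurable.enorm.pow_const s).aemeasurable
    _ ≤ N ^ (s - 1) * ∫⁻ u, (N ^ (1 - s / 2) * (D * D) ^ (s / 2)) * ∑ q ∈ A ×ˢ A', ‖F q u‖ₑ ^ s := by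
        gcongr with u; exact step2 u
    _ = _ := by
        rw [lintegral_const_mul', lintegral_finsetSum]
        · simp only [mul_assoc]
        · intro q _; exact (hF q).measurable.enorm.pow_const s
        · exact ENNReal.mul_ne_top (ENNReal.rpow_ne_top_of_nonneg (by linarith) hNt)
            (ENNReal.rpow_ne_top_of_nonneg (by linarith) (ENNReal.mul_ne_top hDt hDt))

/-- phase -/
noncomputable def ph (p : ℝ × ℝ × ℝ) (ξ : ℝ × ℝ) : ℂ :=
  Complex.exp (Complex.I * (p.1 * ξ.1 * ξ.2 + p.2.1 * ξ.1 + p.2.2 * ξ.2 : ℝ))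

lemma ph_cont : Continuous fun z : (ℝ × ℝ × ℝ) × (ℝ × ℝ) => ph z.1 z.2 := by
  unfold ph; fun_prop

lemma ph_cont' (p : ℝ × ℝ × ℝ) : Continuous (ph p) := by
  unfold ph; fun_prop

lemma norm_exp_I (x : ℝ) : ‖Complex.exp (Complex.I * (x : ℂ))‖ = 1 := by
  rw [mul_comm]; exact Complex.norm_exp_ofReal_mul_I x

lemma ph_norm (p ξ) : ‖ph p ξ‖ = 1 := norm_exp_I _

/-- extension of a set -/
noncomputable def ex (E : Set (ℝ × ℝ)) (p : ℝ × ℝ × ℝ) : ℂ := ∫ ξ in E, ph p ξ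

lemma extOp_chi (E : Set (ℝ × ℝ)) (hE : MeasurableSet E) : extOp (chi E) = ex E := by
  ext p
  rw [extOp, ex, ← integral_indicator hE]
  congr 1; ext ξ
  by_cases h : ξ ∈ E <;> simp [chi, h, ph]

lemma ph_integrable (p) (E : Set (ℝ × ℝ)) (hE : volume E ≠ ∞) : IntegrableOn (ph p) E := by
  have : IsFiniteMeasure (volume.restrict E) := ⟨by simpa using hE.lt_top⟩
  refine (integrable_const (1 : ℝ)).mono' (ph_cont' p).aestronglyMeasurable ?_
  exact Filter.Eventually.of_forall fun ξ => (ph_norm p ξ).le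

lemma ex_cont (E : Set (ℝ × ℝ)) (hE : volume E ≠ ∞) : Continuous (ex E) := by
  have : IsFiniteMeasure (volume.restrict E) := ⟨by simpa using hE.lt_top⟩
  refine continuous_of_dominated (bound := fun _ => 1) (fun p => (ph_cont' p).aestronglyMeasurable)
    (fun p => Filter.Eventually.of_forall fun ξ => (ph_norm p ξ).le) (integrable_const 1)
    (Filter.Eventually.of_forall fun ξ => ?_)
  exact ph_cont.comp (Continuous.prodMk_left ξ)

lemma kernel_integrable (φ : ℝ → ℂ) (hc : Continuous φ) (K : ℝ) (hφ : ∀ v, ‖φ v‖ ≤ K / (1 + v ^ 2)) :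
    Integrable φ := by
  refine (integrable_inv_one_add_sq.const_mul K).mono' hc.aestronglyMeasurable ?_
  exact Filter.Eventually.of_forall fun v => by simpa [div_eq_mul_inv] using hφ v

lemma rep_formula (φ : ℝ → ℂ) (hc : Continuous φ) (hi : Integrable φ)
    (h1 : ∀ w : ℝ, |w| ≤ 1 → ∫ v, φ v * Complex.exp (Complex.I * (w * v : ℝ)) = 1)
    (E1 E2 : Set (ℝ × ℝ)) (hE1 : MeasurableSet E1) (hE2 : MeasurableSet E2) (hf1 : volume E1 ≠ ∞)
    (hf2 : volume E2 ≠ ∞) (ω : ℝ × ℝ) 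
    (hω : ∀ ξ ∈ E1, ∀ ζ ∈ E2, |ω.1 - (ξ.1 + ζ.1)| ≤ 1 ∧ |ω.2 - (ξ.2 + ζ.2)| ≤ 1) (t : ℝ) (x : ℝ × ℝ) :
    ∫ v : ℝ × ℝ, ex E1 (t, x - v) * ex E2 (t, x - v) * (φ v.1 * φ v.2 * 
      Complex.exp (Complex.I * (ω.1 * v.1 + ω.2 * v.2 : ℝ))) = ex E1 (t, x) * ex E2 (t, x) := by
  have i1 : IsFiniteMeasure (volume.restrict E1) := ⟨by simpa using hf1.lt_top⟩
  have i2 : IsFiniteMeasure (volume.restrict E2) := ⟨by simpa using hf2.lt_top⟩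
  set μ := (volume.restrict E1).prod (volume.restrict E2) with hμ
  have hG : ∀ p, ex E1 p * ex E2 p = ∫ y, ph p y.1 * ph p y.2 ∂μ := by
    intro p
    rw [hμ, integral_prod_mul (ph p) (ph p)]; rfl
  simp_rw [hG, ← integral_mul_const]
  have hΦ : Integrable (fun v : ℝ × ℝ => φ v.1 * φ v.2) := hi.mul_prod hi
  rw [integral_integral_swap]
  · have hcongr : ∀ y ∈ E1 ×ˢ E2, ∫ v : ℝ × ℝ, ph (t, x - v) y.1 * ph (t, x - v) y.2 * (φ v.1 * φ v.2 * 
        Complex.exp (Complex.I * (ω.1 * v.1 + ω.2 * v.2 : ℝ))) = ph (t, x) y.1 * ph (t, x) y.2 := by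
      rintro ⟨ξ, ζ⟩ ⟨hξ, hζ⟩
      have hh := hω ξ hξ ζ hζ
      have e : ∀ v : ℝ × ℝ, ph (t, x - v) ξ * ph (t, x - v) ζ * (φ v.1 * φ v.2 * 
        Complex.exp (Complex.I * (ω.1 * v.1 + ω.2 * v.2 : ℝ))) = (ph (t, x) ξ * ph (t, x) ζ) * 
        ((φ v.1 * Complex.exp (Complex.I * ((ω.1 - (ξ.1 + ζ.1)) * v.1 : ℝ))) * 
         (φ v.2 * Complex.exp (Complex.I * ((ω.2 - (ξ.2 + ζ.2)) * v.2 : ℝ)))) := by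
        intro v
        have : ph (t, x - v) ξ * ph (t, x - v) ζ * Complex.exp (Complex.I * (ω.1 * v.1 + ω.2 * v.2 : ℝ)) = 
          (ph (t, x) ξ * ph (t, x) ζ) * (Complex.exp (Complex.I * ((ω.1 - (ξ.1 + ζ.1)) * v.1 : ℝ)) * 
            Complex.exp (Complex.I * ((ω.2 - (ξ.2 + ζ.2)) * v.2 : ℝ))) := by
          simp only [ph, ← Complex.exp_add, Prod.fst_sub, Prod.snd_sub]
          congr 1
          push_cast; ring
        linear_combination (φ v.1 * φ v.2) * this
      simp only [e]
      rw [integral_const_mul, Measure.volume_eq_prod, integral_prod_mul 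
        (fun a => φ a * Complex.exp (Complex.I * ((ω.1 - (ξ.1 + ζ.1)) * a : ℝ)))
        (fun a => φ a * Complex.exp (Complex.I * ((ω.2 - (ξ.2 + ζ.2)) * a : ℝ))), h1 _ hh.1, h1 _ hh.2]
      simp
    rw [hμ, Measure.prod_restrict]
    exact setIntegral_congr_fun (hE1.prod hE2) hcongr
  · have hdom : Integrable (fun z : (ℝ × ℝ) × ((ℝ × ℝ) × (ℝ × ℝ)) => φ z.1.1 * φ z.1.2 * (1 : ℂ)) (volume.prod μ) :=
      hΦ.mul_prod (integrable_const (1 : ℂ))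
    refine hdom.mono ?_ ?_
    · apply Continuous.aestronglyMeasurable
      unfold Function.uncurry ph
      simp only [Prod.fst_sub, Prod.snd_sub]
      fun_prop
    · refine Filter.Eventually.of_forall fun z => ?_
      simp only [Function.uncurry, norm_mul, ph_norm, norm_exp_I, norm_one, mul_one, one_mul]
      exact le_rfl

lemma ex_norm_le (E : Set (ℝ × ℝ)) (hE : volume E ≠ ∞) (p) : ‖ex E p‖ ≤ (volume E).toReal := by
  have := norm_setIntegral_le_of_norm_le_const (f := ph p) (C := 1) hE.lt_top (fun x _ => (ph_norm p x).le)
  simpa [ex, measureReal_def] using this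

lemma unitSq_finite (a b : ℝ) : volume (unitSq a b) = 1 := by
  rw [unitSq, Measure.volume_eq_prod, Measure.prod_prod, Real.volume_Icc, Real.volume_Icc]
  simp

lemma offset_AO (s : ℝ) (hs1 : 1 ≤ s) (hs2 : s ≤ 2) :
    ∃ C : ℝ≥0∞, C ≠ ∞ ∧ ∀ (d : ℤ × ℤ) (E E' : ℤ × ℤ → Set (ℝ × ℝ)) (A A' : Finset ℤ),
      (∀ q, MeasurableSet (E q)) → (∀ q, MeasurableSet (E' q)) → (∀ q, E q ⊆ unitSq q.1 q.2) →
      (∀ q, E' q ⊆ unitSq ((q.1 + d.1 : ℤ) : ℝ) ((q.2 + d.2 : ℤ) : ℝ)) →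
      ∫⁻ p : ℝ × ℝ × ℝ, ‖∑ q ∈ A ×ˢ A', ex (E q) p * ex (E' q) p‖ₑ ^ s ≤
        C * ∑ q ∈ A ×ˢ A', ∫⁻ p : ℝ × ℝ × ℝ, ‖ex (E q) p * ex (E' q) p‖ₑ ^ s := by
  obtain ⟨φ, hc, ⟨K, hK, hφ⟩, h1⟩ := exists_kernel
  have hi := kernel_integrable φ hc K hφ
  obtain ⟨D, hDt, hD⟩ := weighted_L2 φ K hK hφ
  have hm : Measurable fun v => ‖φ v‖ₑ := hc.measurable.enorm
  set ν : Measure ℝ := volume.withDensity fun v => ‖φ v‖ₑ with hν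
  have : IsFiniteMeasure ν := isFiniteMeasure_withDensity hi.2.ne
  obtain ⟨C, hCt, hC⟩ := AO ν D hDt (by
    intro a A
    have hcc : Continuous fun v : ℝ => ∑ m ∈ A, a m * Complex.exp (Complex.I * (2 * m * v : ℝ)) := by fun_prop
    rw [hν, lintegral_withDensity_eq_lintegral_mul _ hm (hcc.measurable.enorm.pow_const 2)]
    exact hD a A) s hs1 hs2
  refine ⟨C, hCt, fun d E E' A A' hE hE' hEs hEs' => ?_⟩
  have hf : ∀ q, volume (E q) ≠ ∞ := fun q => 
    ((measure_mono (hEs q)).trans_lt (by rw [unitSq_finite]; simp)).ne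
  have hf' : ∀ q, volume (E' q) ≠ ∞ := fun q => 
    ((measure_mono (hEs' q)).trans_lt (by rw [unitSq_finite]; simp)).ne
  have hco := fun q => ex_cont (E q) (hf q)
  have hco' := fun q => ex_cont (E' q) (hf' q)
  have hΦ : Integrable (fun v : ℝ × ℝ => φ v.1 * φ v.2) := hi.mul_prod hi
  have key : ∀ t : ℝ, ∫⁻ x : ℝ × ℝ, ‖∑ q ∈ A ×ˢ A', ex (E q) (t, x) * ex (E' q) (t, x)‖ₑ ^ s ≤
        C * ∑ q ∈ A ×ˢ A', ∫⁻ x : ℝ × ℝ, ‖ex (E q) (t, x) * ex (E' q) (t, x)‖ₑ ^ s := by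
    intro t
    refine hC (fun q x => ex (E q) (t, x) * ex (E' q) (t, x)) A A' (fun q => by fun_prop) fun x => ?_
    have hrep : ∀ q : ℤ × ℤ, ∫ v : ℝ × ℝ, ex (E q) (t, x - v) * ex (E' q) (t, x - v) * (φ v.1 * φ v.2 * 
      Complex.exp (Complex.I * ((2 * q.1 + d.1 + 1) * v.1 + (2 * q.2 + d.2 + 1) * v.2 : ℝ))) 
        = ex (E q) (t, x) * ex (E' q) (t, x) := by
      intro q
      refine rep_formula φ hc hi h1 (E q) (E' q) (hE q) (hE' q) (hf q) (hf' q) 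
        ((2 * q.1 + d.1 + 1 : ℝ), (2 * q.2 + d.2 + 1 : ℝ)) ?_ t x
      intro ξ hξ ζ hζ
      have a1 := hEs q hξ
      have a2 := hEs' q hζ
      simp only [unitSq, mem_prod, mem_Icc] at a1 a2
      push_cast at a2
      simp only [abs_le]
      refine ⟨⟨?_, ?_⟩, ⟨?_, ?_⟩⟩ <;> linarith [a1.1.1, a1.1.2, a1.2.1, a1.2.2, a2.1.1, a2.1.2, a2.2.1, a2.2.2]
    have h_integ : ∀ q : ℤ × ℤ, Integrable fun v : ℝ × ℝ => 
      ex (E q) (t, x - v) * ex (E' q) (t, x - v) * (φ v.1 * φ v.2 * 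
      Complex.exp (Complex.I * ((2 * q.1 + d.1 + 1) * v.1 + (2 * q.2 + d.2 + 1) * v.2 : ℝ))) := by
      intro q
      refine (hΦ.norm.const_mul ((volume (E q)).toReal * (volume (E' q)).toReal)).mono' ?_ ?_
      · apply Continuous.aestronglyMeasurable; fun_prop
      · refine Filter.Eventually.of_forall fun v => ?_
        rw [norm_mul, norm_mul _ (Complex.exp _), norm_exp_I, mul_one, norm_mul (ex _ _)]
        gcongr
        · exact ex_norm_le _ (hf q) _
        · exact ex_norm_le _ (hf' q) _
    simp only [← hrep]
    rw [← integral_finsetSum _ fun q _ => h_integ q]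
    refine (enorm_integral_le_lintegral_enorm _).trans (le_of_eq ?_)
    have hchr := chr_cont
    rw [hν, prod_withDensity hm hm, lintegral_withDensity_eq_lintegral_mul]
    · rw [← Measure.volume_eq_prod]
      refine lintegral_congr fun v => ?_
      have : ∑ q ∈ A ×ˢ A', ex (E q) (t, x - v) * ex (E' q) (t, x - v) * (φ v.1 * φ v.2 * 
        Complex.exp (Complex.I * ((2 * q.1 + d.1 + 1) * v.1 + (2 * q.2 + d.2 + 1) * v.2 : ℝ))) = 
        (φ v.1 * φ v.2 * Complex.exp (Complex.I * ((d.1 + 1) * v.1 + (d.2 + 1) * v.2 : ℝ))) * 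
         ∑ q ∈ A ×ˢ A', ex (E q) (t, x - v) * ex (E' q) (t, x - v) * chr q v := by
        rw [Finset.mul_sum]
        refine Finset.sum_congr rfl fun q _ => ?_
        have : Complex.exp (Complex.I * ((2 * q.1 + d.1 + 1) * v.1 + (2 * q.2 + d.2 + 1) * v.2 : ℝ)) = 
          Complex.exp (Complex.I * ((d.1 + 1) * v.1 + (d.2 + 1) * v.2 : ℝ)) * chr q v := by
          rw [chr, ← Complex.exp_add]; congr 1; push_cast; ring
        rw [this]; ring
      rw [this, enorm_mul]
      have e1 : ‖Complex.exp (Complex.I * ((d.1 + 1) * v.1 + (d.2 + 1) * v.2 : ℝ))‖ₑ = 1 := by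
        rw [← ofReal_norm, norm_exp_I]; simp
      rw [enorm_mul, enorm_mul, e1, mul_one]
      simp only [Pi.mul_apply]
    · fun_prop
    · have : Continuous fun v => ∑ q ∈ A ×ˢ A', ex (E q) (t, x - v) * ex (E' q) (t, x - v) * chr q v := by fun_prop
      exact this.measurable.enorm
  have hmeas : ∀ q : ℤ × ℤ, Measurable fun p : ℝ × ℝ × ℝ => ‖ex (E q) p * ex (E' q) p‖ₑ ^ s := fun q =>
    ((hco q).mul (hco' q)).measurable.enorm.pow_const s
  have hmeas' : Measurable fun p : ℝ × ℝ × ℝ => ‖∑ q ∈ A ×ˢ A', ex (E q) p * ex (E' q) p‖ₑ ^ s := by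
    have : Continuous fun p : ℝ × ℝ × ℝ => ∑ q ∈ A ×ˢ A', ex (E q) p * ex (E' q) p := by fun_prop
    exact this.measurable.enorm.pow_const s
  rw [Measure.volume_eq_prod, lintegral_prod _ hmeas'.aemeasurable]
  refine (lintegral_mono key).trans (le_of_eq ?_)
  rw [lintegral_const_mul' _ _ hCt, lintegral_finsetSum]
  · congr 1
    refine Finset.sum_congr rfl fun q _ => ?_
    rw [lintegral_prod _ (hmeas q).aemeasurable]
  · intro q _; exact (hmeas q).lintegral_prod_right'

/-- half-open unit tile via floors -/
def HO (q : ℤ × ℤ) : Set (ℝ × ℝ) := {ξ | ⌊ξ.1⌋ = q.1 ∧ ⌊ξ.2⌋ = q.2}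

lemma HO_meas (q) : MeasurableSet (HO q) := by
  have h1 : Measurable fun ξ : ℝ × ℝ => ⌊ξ.1⌋ := Int.measurable_floor.comp measurable_fst
  have h2 : Measurable fun ξ : ℝ × ℝ => ⌊ξ.2⌋ := Int.measurable_floor.comp measurable_snd
  exact (h1 (measurableSet_singleton q.1)).inter (h2 (measurableSet_singleton q.2))

lemma HO_sub (q) : HO q ⊆ unitSq q.1 q.2 := by
  rintro ξ ⟨h1, h2⟩
  rw [Int.floor_eq_iff] at h1 h2
  exact ⟨⟨h1.1, h1.2.le⟩, ⟨h2.1, h2.2.le⟩⟩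

/-- Whitney relation -/
def rel (m m' : ℤ) : Prop := 2 ≤ |m - m'| ∧ |m / 2 - m' / 2| ≤ 1

lemma rel_off {m m' : ℤ} (h : rel m m') : m' - m ∈ ({-3, -2, 2, 3} : Finset ℤ) := by
  obtain ⟨h1, h2⟩ := h
  simp only [Finset.mem_insert, Finset.mem_singleton]
  rw [abs_le] at h2
  rw [le_abs] at h1
  omega

lemma BH_char (s r A : ℝ) (hs : 0 < s) (hBH : BH s r A) (E F : Set (ℝ × ℝ)) (hE : MeasurableSet E) (hF : MeasurableSet F)
    (a₁ a₂ b₁ b₂ : ℝ) (h1 : 2 ≤ |a₁ - b₁|) (h2 : |a₁ - b₁| ≤ 5) (h3 : 2 ≤ |a₂ - b₂|) (h4 : |a₂ - b₂| ≤ 5)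
    (hEs : E ⊆ unitSq a₁ a₂) (hFs : F ⊆ unitSq b₁ b₂) :
    ∫⁻ p : ℝ × ℝ × ℝ, ‖ex E p * ex F p‖ₑ ^ s ≤ 
      ENNReal.ofReal A ^ s * (volume E * volume F) ^ (s / max r 2) := by
  have hn : ∀ (G : Set (ℝ × ℝ)) (a b : ℝ), MeasurableSet G → G ⊆ unitSq a b → 
      eLpNorm (chi G) (ENNReal.ofReal r) volume ≤ volume G ^ (1 / max r 2) := by
    intro G a b hG hGs
    rcases le_or_gt r 0 with hr | hr
    · rw [ENNReal.ofReal_of_nonpos hr]; simp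
    · rw [chi, eLpNorm_indicator_const hG (by simpa using hr) ENNReal.ofReal_ne_top, ENNReal.toReal_ofReal hr.le]
      simp only [enorm_one, one_mul]
      apply ENNReal.rpow_le_rpow_of_exponent_ge
      · exact (measure_mono hGs).trans (unitSq_finite a b).le
      · exact one_div_le_one_div_of_le hr (le_max_left _ _)
  have hsupp : ∀ G : Set (ℝ × ℝ), Function.support (chi G) ⊆ G := by
    intro G; exact support_indicator_subset
  have hb := hBH a₁ a₂ b₁ b₂ h1 h2 h3 h4 (chi E) (chi F) ((hsupp E).trans hEs) ((hsupp F).trans hFs)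
  rw [extOp_chi E hE, extOp_chi F hF, eLpNorm_eq_lintegral_rpow_enorm_toReal (by simpa using hs) ENNReal.ofReal_ne_top,
    ENNReal.toReal_ofReal hs.le] at hb
  have hb2 := hb.trans (mul_le_mul' (mul_le_mul' le_rfl (hn E a₁ a₂ hE hEs)) (hn F b₁ b₂ hF hFs))
  have hb3 := ENNReal.rpow_le_rpow hb2 hs.le
  rw [← ENNReal.rpow_mul, one_div_mul_cancel hs.ne', ENNReal.rpow_one] at hb3
  refine hb3.trans (le_of_eq ?_)
  have hmx : 0 < max r 2 := lt_max_of_lt_right two_pos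
  rw [mul_assoc, ← ENNReal.mul_rpow_of_nonneg _ _ (by positivity : (0:ℝ) ≤ 1 / max r 2), ENNReal.mul_rpow_of_nonneg _ _ hs.le, ← ENNReal.rpow_mul]
  congr 2; ring

/-- bilinear Whitney piece -/
def Wset : Set ((ℝ × ℝ) × (ℝ × ℝ)) := {y | rel ⌊y.1.1⌋ ⌊y.2.1⌋ ∧ rel ⌊y.1.2⌋ ⌊y.2.2⌋}

/-- bilinear extension over a set of pairs -/
noncomputable def bex (V : Set ((ℝ × ℝ) × (ℝ × ℝ))) (p : ℝ × ℝ × ℝ) : ℂ := ∫ y in V, ph p y.1 * ph p y.2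

lemma bex_prod (E F : Set (ℝ × ℝ)) (p) : bex (E ×ˢ F) p = ex E p * ex F p := by
  rw [bex, ex, ex, Measure.volume_eq_prod, setIntegral_prod_mul (ph p) (ph p)]

lemma two_rpow_bound (x y M : ℝ≥0∞) (hx : x ≤ M) (hy : y ≤ M) (k : ℝ) (hk : 1 ≤ 2 * k) :
    (x * y) ^ k ≤ M ^ (2 * k - 1) * (x + y) := by
  have aux : ∀ z, z ≤ M → (z * z) ^ k ≤ M ^ (2 * k - 1) * z := by
    intro z hz
    rw [ENNReal.mul_rpow_of_nonneg _ _ (by linarith), ← ENNReal.rpow_add_of_nonneg _ _ (by linarith) (by linarith)]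
    have : k + k = (2 * k - 1) + 1 := by ring
    rw [this, ENNReal.rpow_add_of_nonneg _ _ (by linarith) (by linarith), ENNReal.rpow_one]
    gcongr
  rcases le_total x y with h | h
  · calc (x * y) ^ k ≤ (y * y) ^ k := by gcongr; linarith
      _ ≤ M ^ (2 * k - 1) * y := aux y hy
      _ ≤ _ := by gcongr; exact le_add_self
  · calc (x * y) ^ k ≤ (x * x) ^ k := by gcongr; linarith
      _ ≤ M ^ (2 * k - 1) * x := aux x hx
      _ ≤ _ := by gcongr; exact le_self_add

lemma bex_unit_eq (E : Set (ℝ × ℝ)) (hE : MeasurableSet E) (hf : volume E ≠ ∞) (A A' : Finset ℤ)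
    (hA : ∀ ξ ∈ E, ⌊ξ.1⌋ ∈ A ∧ ⌊ξ.2⌋ ∈ A') (p : ℝ × ℝ × ℝ) (E1 : ℤ × ℤ → ℤ × ℤ → Set (ℝ × ℝ)) 
    (hE1 : ∀ d q, E1 d q = {ξ ∈ E ∩ HO q | rel q.1 (q.1 + d.1) ∧ rel q.2 (q.2 + d.2)})
    (hE1m : ∀ d q, MeasurableSet (E1 d q)) (Dd : Finset ℤ) (hDd : Dd = {-3, -2, 2, 3}) :
    bex (E ×ˢ E ∩ Wset) p = ∑ d ∈ Dd ×ˢ Dd, ∑ q ∈ A ×ˢ A', ex (E1 d q) p * ex (E ∩ HO (q + d)) p := by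
  rw [← Finset.sum_product']
  simp_rw [← bex_prod, bex]
  have hU : E ×ˢ E ∩ Wset = ⋃ z ∈ (Dd ×ˢ Dd) ×ˢ (A ×ˢ A'), (E1 z.1 z.2) ×ˢ (E ∩ HO (z.2 + z.1)) := by
    ext ⟨ξ, ζ⟩
    simp only [mem_inter_iff, mem_prod, Wset, mem_setOf_eq, mem_iUnion, hE1, HO, exists_prop, Finset.mem_product,
      Prod.fst_add, Prod.snd_add]
    constructor
    · rintro ⟨⟨h1, h2⟩, h3, h4⟩
      refine ⟨((⌊ζ.1⌋ - ⌊ξ.1⌋, ⌊ζ.2⌋ - ⌊ξ.2⌋), (⌊ξ.1⌋, ⌊ξ.2⌋)), ⟨⟨hDd ▸ rel_off h3, hDd ▸ rel_off h4⟩, hA ξ h1⟩, ?_⟩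
      simp [h1, h2, h3, h4]
    · rintro ⟨⟨⟨d1, d2⟩, ⟨q1, q2⟩⟩, -, ⟨⟨h1, h2, h3⟩, h4, h5⟩, h6, h7, h8⟩
      simp only at *
      refine ⟨⟨h1, h6⟩, ?_, ?_⟩
      · rw [h2, h7]; exact h4
      · rw [h3, h8]; exact h5
  rw [hU, integral_biUnion_finset]
  · rintro z -; exact (hE1m _ _).prod (hE.inter (HO_meas _))
  · rintro z - w - hzw
    rw [Function.onFun, Set.disjoint_left]
    rintro ⟨ξ, ζ⟩ ⟨h1, h2⟩ ⟨h3, h4⟩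
    simp only [hE1] at h1 h3
    apply hzw
    have a1 := h1.1.2; have a2 := h3.1.2; have a3 := h2.2; have a4 := h4.2
    simp only [HO, mem_setOf_eq, Prod.fst_add, Prod.snd_add] at a1 a2 a3 a4
    ext <;> omega
  · intro z _
    have h1 : volume (E1 z.1 z.2) ≠ ∞ := ne_top_of_le_ne_top hf (measure_mono (by rw [hE1]; intro x hx; exact hx.1.1))
    have h2 : volume (E ∩ HO (z.2 + z.1)) ≠ ∞ := ne_top_of_le_ne_top hf (measure_mono inter_subset_left)
    have := (ph_integrable p _ h1).mul_prod (ph_integrable p _ h2)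
    rwa [Measure.prod_restrict] at this

lemma unit_scale (s r A : ℝ) (hs1 : 1 ≤ s) (hs2 : s ≤ 2) (hBH : BH s r A) (hk : 1 ≤ 2 * (s / max r 2)) :
    ∃ C : ℝ≥0∞, C ≠ ∞ ∧ ∀ (E : Set (ℝ × ℝ)) (A A' : Finset ℤ) (M : ℝ≥0∞), MeasurableSet E → volume E ≠ ∞ → 
      (∀ ξ ∈ E, ⌊ξ.1⌋ ∈ A ∧ ⌊ξ.2⌋ ∈ A') → (∀ q, volume (E ∩ HO q) ≤ M) → 
      ∫⁻ p, ‖bex (E ×ˢ E ∩ Wset) p‖ₑ ^ s ≤ C * (M ^ (2 * (s / max r 2) - 1) * volume E) := by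
  classical
  obtain ⟨C, hCt, hC⟩ := offset_AO s hs1 hs2
  have hs0 : 0 < s := by linarith
  have hAt : ENNReal.ofReal A ^ s ≠ ∞ := ENNReal.rpow_ne_top_of_nonneg hs0.le ENNReal.ofReal_ne_top
  let Dd : Finset ℤ := {-3, -2, 2, 3}
  let n : ℝ≥0∞ := ((Dd ×ˢ Dd).card : ℝ≥0∞)
  have hnt : n ^ (s - 1) ≠ ∞ := ENNReal.rpow_ne_top_of_nonneg (by linarith) (ENNReal.natCast_ne_top _)
  refine ⟨n ^ (s - 1) * (n * (C * (ENNReal.ofReal A ^ s * 2))), ?_, ?_⟩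
  · refine ENNReal.mul_ne_top hnt (ENNReal.mul_ne_top (ENNReal.natCast_ne_top _) (ENNReal.mul_ne_top hCt (ENNReal.mul_ne_top hAt (by simp))))
  intro E B B' M hE hf hA hM
  let E1 : ℤ × ℤ → ℤ × ℤ → Set (ℝ × ℝ) := fun d q => {ξ ∈ E ∩ HO q | rel q.1 (q.1 + d.1) ∧ rel q.2 (q.2 + d.2)}
  have hE1m : ∀ d q, MeasurableSet (E1 d q) := by
    intro d q
    by_cases h : rel q.1 (q.1 + d.1) ∧ rel q.2 (q.2 + d.2)
    · have : E1 d q = E ∩ HO q := by ext ξ; simp [E1, h]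
      rw [this]; exact hE.inter (HO_meas q)
    · have : E1 d q = ∅ := by ext ξ; simp only [E1, h]; simp
      rw [this]; exact MeasurableSet.empty
  simp_rw [fun p => bex_unit_eq E hE hf B B' hA p E1 (fun _ _ => rfl) hE1m Dd rfl]
  have hE1s : ∀ d q, E1 d q ⊆ E ∩ HO q := fun d q x hx => hx.1
  have hsum : ∀ d : ℤ × ℤ, ∑ q ∈ B ×ˢ B', volume (E ∩ HO (q + d)) ≤ volume E := by
    intro d
    rw [← measure_biUnion_finset]
    · exact measure_mono (iUnion₂_subset fun q _ => inter_subset_left)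
    · rintro q - q' - hqq
      rw [Function.onFun, Set.disjoint_left]
      rintro ξ ⟨-, h1⟩ ⟨-, h2⟩
      apply hqq
      simp only [HO, mem_setOf_eq, Prod.fst_add, Prod.snd_add] at h1 h2
      ext <;> omega
    · intro q _; exact hE.inter (HO_meas _)
  have hone : ∀ d ∈ Dd ×ˢ Dd, ∀ q, ∫⁻ p, ‖ex (E1 d q) p * ex (E ∩ HO (q + d)) p‖ₑ ^ s ≤ 
      ENNReal.ofReal A ^ s * (M ^ (2 * (s / max r 2) - 1) * (volume (E ∩ HO q) + volume (E ∩ HO (q + d)))) := by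
    intro d hd q
    have habs : ∀ (a : ℤ), a ∈ Dd → ∀ m : ℤ, 2 ≤ |(m : ℝ) - ((m + a : ℤ) : ℝ)| ∧ |(m : ℝ) - ((m + a : ℤ) : ℝ)| ≤ 5 := by
      intro a ha m
      have : (m : ℝ) - ((m + a : ℤ) : ℝ) = -(a : ℝ) := by push_cast; ring
      rw [this, abs_neg]
      simp only [Dd, Finset.mem_insert, Finset.mem_singleton] at ha
      rcases ha with rfl | rfl | rfl | rfl <;> norm_num
    rw [Finset.mem_product] at hd
    refine (BH_char s r A hs0 hBH (E1 d q) (E ∩ HO (q + d)) (hE1m d q) (hE.inter (HO_meas _)) q.1 q.2 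
      ((q.1 + d.1 : ℤ) : ℝ) ((q.2 + d.2 : ℤ) : ℝ) (habs _ hd.1 _).1 (habs _ hd.1 _).2 (habs _ hd.2 _).1 (habs _ hd.2 _).2
      ((hE1s d q).trans (inter_subset_right.trans (HO_sub q))) (inter_subset_right.trans (HO_sub _))).trans ?_
    gcongr
    refine le_trans ?_ (two_rpow_bound _ _ M (hM q) (hM (q + d)) _ hk)
    gcongr
    exact hE1s d q
  have hcont : ∀ d, Continuous fun p => ∑ q ∈ B ×ˢ B', ex (E1 d q) p * ex (E ∩ HO (q + d)) p := by
    intro d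
    have h1 := fun q => ex_cont (E1 d q) (ne_top_of_le_ne_top hf (measure_mono ((hE1s d q).trans inter_subset_left)))
    have h2 := fun q => ex_cont (E ∩ HO (q + d)) (ne_top_of_le_ne_top hf (measure_mono inter_subset_left))
    fun_prop
  calc ∫⁻ p, ‖∑ d ∈ Dd ×ˢ Dd, ∑ q ∈ B ×ˢ B', ex (E1 d q) p * ex (E ∩ HO (q + d)) p‖ₑ ^ s 
      ≤ ∫⁻ p, n ^ (s - 1) * ∑ d ∈ Dd ×ˢ Dd, ‖∑ q ∈ B ×ˢ B', ex (E1 d q) p * ex (E ∩ HO (q + d)) p‖ₑ ^ s := by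
        refine lintegral_mono fun p => ?_
        refine le_trans ?_ (ENNReal.rpow_sum_le_const_mul_sum_rpow _ _ hs1)
        gcongr
        exact enorm_sum_le _ _
    _ = n ^ (s - 1) * ∑ d ∈ Dd ×ˢ Dd, ∫⁻ p, ‖∑ q ∈ B ×ˢ B', ex (E1 d q) p * ex (E ∩ HO (q + d)) p‖ₑ ^ s := by
        rw [lintegral_const_mul' _ _ hnt, lintegral_finsetSum]
        intro d _; exact (hcont d).measurable.enorm.pow_const s
    _ ≤ n ^ (s - 1) * ∑ d ∈ Dd ×ˢ Dd, (C * (ENNReal.ofReal A ^ s * 2)) * (M ^ (2 * (s / max r 2) - 1) * volume E) := by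
        gcongr with d hd
        refine (hC d (E1 d) (fun q => E ∩ HO (q + d)) B B' (hE1m d) (fun q => hE.inter (HO_meas _))
          (fun q => (hE1s d q).trans (inter_subset_right.trans (HO_sub q))) 
          (fun q => inter_subset_right.trans (HO_sub _))).trans ?_
        rw [mul_assoc]
        gcongr
        refine (Finset.sum_le_sum fun q _ => hone d hd q).trans ?_
        rw [← Finset.mul_sum, ← Finset.mul_sum, Finset.sum_add_distrib]
        have h0 := hsum 0
        simp only [add_zero] at h0
        have h2 : ∑ q ∈ B ×ˢ B', volume (E ∩ HO q) + ∑ q ∈ B ×ˢ B', volume (E ∩ HO (q + d)) ≤ 2 * volume E := by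
          rw [two_mul]; exact add_le_add h0 (hsum d)
        calc ENNReal.ofReal A ^ s * (M ^ (2 * (s / max r 2) - 1) * (∑ q ∈ B ×ˢ B', volume (E ∩ HO q) + ∑ q ∈ B ×ˢ B', volume (E ∩ HO (q + d))))
            ≤ ENNReal.ofReal A ^ s * (M ^ (2 * (s / max r 2) - 1) * (2 * volume E)) := by gcongr
          _ = _ := by ring
    _ = _ := by
        rw [Finset.sum_const, nsmul_eq_mul]
        simp only [n]; ring

/-- anisotropic scaling -/
def sc (a b : ℝ) (ξ : ℝ × ℝ) : ℝ × ℝ := (a * ξ.1, b * ξ.2)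

/-- dual scaling -/
def sd (α β γ : ℝ) (p : ℝ × ℝ × ℝ) : ℝ × ℝ × ℝ := (α * p.1, β * p.2.1, γ * p.2.2)

lemma sc_emb {a b : ℝ} (ha : 0 < a) (hb : 0 < b) : MeasurableEmbedding (sc a b) := 
  (measurableEmbedding_mulLeft₀ ha.ne').prodMap (measurableEmbedding_mulLeft₀ hb.ne')

lemma sc_map {a b : ℝ} (ha : 0 < a) (hb : 0 < b) : 
    Measure.map (sc a b) volume = ENNReal.ofReal ((a * b)⁻¹) • volume := by
  have h : sc a b = Prod.map (a * ·) (b * ·) := rfl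
  rw [h, Measure.volume_eq_prod, ← Measure.map_prod_map _ _ (by fun_prop) (by fun_prop), Real.map_volume_mul_left ha.ne', 
    Real.map_volume_mul_left hb.ne', Measure.prod_smul_left, Measure.prod_smul_right, smul_smul, 
    ← ENNReal.ofReal_mul (abs_nonneg _), abs_of_pos (inv_pos.2 ha), abs_of_pos (inv_pos.2 hb), mul_inv]

lemma sd_emb {a b c : ℝ} (ha : 0 < a) (hb : 0 < b) (hc : 0 < c) : MeasurableEmbedding (sd a b c) := 
  (measurableEmbedding_mulLeft₀ ha.ne').prodMap ((measurableEmbedding_mulLeft₀ hb.ne').prodMap (measurableEmbedding_mulLeft₀ hc.ne'))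

lemma sd_map {a b c : ℝ} (ha : 0 < a) (hb : 0 < b) (hc : 0 < c) : 
    Measure.map (sd a b c) volume = ENNReal.ofReal ((a * (b * c))⁻¹) • volume := by
  have h : sd a b c = Prod.map (a * ·) (sc b c) := rfl
  rw [h, Measure.volume_eq_prod, ← Measure.map_prod_map _ _ (by fun_prop) (sc_emb hb hc).measurable, Real.map_volume_mul_left ha.ne', 
    sc_map hb hc, Measure.prod_smul_left, Measure.prod_smul_right, smul_smul, 
    ← ENNReal.ofReal_mul (abs_nonneg _), abs_of_pos (inv_pos.2 ha), mul_inv a]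

lemma sc_vol {a b : ℝ} (ha : 0 < a) (hb : 0 < b) (E : Set (ℝ × ℝ)) : 
    volume E = ENNReal.ofReal (a * b) * volume (sc a b ⁻¹' E) := by
  rw [← (sc_emb ha hb).map_apply, sc_map ha hb, Measure.smul_apply, smul_eq_mul, ← mul_assoc, 
    ← ENNReal.ofReal_mul (by positivity), mul_inv_cancel₀ (by positivity)]
  simp

/-- Whitney piece at a scale -/
def Wab (a b : ℝ) : Set ((ℝ × ℝ) × (ℝ × ℝ)) := Prod.map (sc a b) (sc a b) ⁻¹' Wset

lemma bex_scale {a b : ℝ} (ha : 0 < a) (hb : 0 < b) (U : Set ((ℝ × ℝ) × (ℝ × ℝ))) (p) :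
    bex (Prod.map (sc a b) (sc a b) ⁻¹' U) p = (((a * b)⁻¹ ^ 2 : ℝ) : ℂ) * bex U (sd (a * b)⁻¹ a⁻¹ b⁻¹ p) := by
  have hph : ∀ ξ, ph p ξ = ph (sd (a * b)⁻¹ a⁻¹ b⁻¹ p) (sc a b ξ) := by
    intro ξ
    simp only [ph, sd, sc]
    congr 3
    field_simp
  have hm : Measure.map (Prod.map (sc a b) (sc a b)) volume = ENNReal.ofReal ((a * b)⁻¹ ^ 2) • volume := by
    rw [Measure.volume_eq_prod, ← Measure.map_prod_map _ _ (sc_emb ha hb).measurable (sc_emb ha hb).measurable, sc_map ha hb,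
      Measure.prod_smul_left, Measure.prod_smul_right, smul_smul, ← ENNReal.ofReal_mul (by positivity), pow_two]
  have he := (sc_emb ha hb).prodMap (sc_emb ha hb)
  have := he.setIntegral_map (μ := volume) (fun y => ph (sd (a * b)⁻¹ a⁻¹ b⁻¹ p) y.1 * ph (sd (a * b)⁻¹ a⁻¹ b⁻¹ p) y.2) U
  rw [hm, Measure.restrict_smul, integral_smul_measure, ENNReal.toReal_ofReal (by positivity)] at this
  rw [bex, bex, ← Complex.real_smul, this]
  simp only [hph, Prod.map_fst, Prod.map_snd]

lemma scaled (s r A : ℝ) (hs1 : 1 ≤ s) (hs2 : s ≤ 2) (hBH : BH s r A) (hk : 1 ≤ 2 * (s / max r 2)) :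
    ∃ C : ℝ≥0∞, C ≠ ∞ ∧ ∀ (Ω : Set (ℝ × ℝ)) (a b : ℝ) (M : ℝ≥0∞), 0 < a → 0 < b → MeasurableSet Ω → Ω ⊆ Icc 0 1 ×ˢ Icc 0 1 → 
      (∀ q, volume (Ω ∩ sc a b ⁻¹' HO q) ≤ M) → 
      ∫⁻ p, ‖bex (Ω ×ˢ Ω ∩ Wab a b) p‖ₑ ^ s ≤ C * (ENNReal.ofReal (a * b) ^ (2 - 2 * s) * 
        ((ENNReal.ofReal (a * b) * M) ^ (2 * (s / max r 2) - 1) * (ENNReal.ofReal (a * b) * volume Ω))) := by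
  obtain ⟨C, hCt, hC⟩ := unit_scale s r A hs1 hs2 hBH hk
  refine ⟨C, hCt, ?_⟩
  intro Ω a b M ha hb hΩ hΩs hM
  set E : Set (ℝ × ℝ) := sc a⁻¹ b⁻¹ ⁻¹' Ω with hE
  have hinv : sc a b ⁻¹' E = Ω := by
    ext ξ
    simp [hE, sc, ha.ne', hb.ne']
  have hEm : MeasurableSet E := (sc_emb (inv_pos.2 ha) (inv_pos.2 hb)).measurable hΩ
  have hvE : volume E = ENNReal.ofReal (a * b) * volume Ω := by rw [sc_vol ha hb, hinv]
  have hΩf : volume Ω ≠ ∞ := by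
    have := unitSq_finite 0 0
    simp only [unitSq, zero_add] at this
    exact ne_top_of_le_ne_top (by rw [this]; simp) (measure_mono hΩs)
  have hU : Ω ×ˢ Ω ∩ Wab a b = Prod.map (sc a b) (sc a b) ⁻¹' (E ×ˢ E ∩ Wset) := by
    rw [preimage_inter, ← Wab]
    congr 1
    rw [← hinv]; rfl
  have hfl : ∀ ξ ∈ E, ⌊ξ.1⌋ ∈ Finset.Icc 0 ⌊a⌋ ∧ ⌊ξ.2⌋ ∈ Finset.Icc 0 ⌊b⌋ := by
    intro ξ hξ
    have h := hΩs hξ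
    simp only [sc, mem_prod, mem_Icc] at h
    rw [inv_mul_le_iff₀ ha, inv_mul_le_iff₀ hb, inv_mul_eq_div, inv_mul_eq_div] at h
    have h1 : 0 ≤ ξ.1 := by
      have := mul_nonneg h.1.1 ha.le; rwa [div_mul_cancel₀ _ ha.ne'] at this
    have h2 : 0 ≤ ξ.2 := by
      have := mul_nonneg h.2.1 hb.le; rwa [div_mul_cancel₀ _ hb.ne'] at this
    simp only [Finset.mem_Icc]
    exact ⟨⟨Int.floor_nonneg.2 h1, Int.floor_mono (by linarith [h.1.2])⟩, ⟨Int.floor_nonneg.2 h2, Int.floor_mono (by linarith [h.2.2])⟩⟩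
  have hu := hC E _ _ (ENNReal.ofReal (a * b) * M) hEm (by rw [hvE]; exact ENNReal.mul_ne_top ENNReal.ofReal_ne_top hΩf) hfl (by
    intro q
    rw [sc_vol ha hb, preimage_inter, hinv]
    gcongr
    exact hM q)
  rw [hvE] at hu
  have hab : 0 < a * b := by positivity
  have hN0 : ENNReal.ofReal (a * b) ≠ 0 := by simpa using hab
  have key : ∫⁻ p, ‖bex (Ω ×ˢ Ω ∩ Wab a b) p‖ₑ ^ s = ENNReal.ofReal (a * b) ^ (2 - 2 * s) * ∫⁻ p, ‖bex (E ×ˢ E ∩ Wset) p‖ₑ ^ s := by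
    rw [hU]
    simp_rw [bex_scale ha hb, enorm_mul, ENNReal.mul_rpow_of_nonneg _ _ (by linarith : 0 ≤ s)]
    have hc : ‖(((a * b)⁻¹ ^ 2 : ℝ) : ℂ)‖ₑ ^ s = ENNReal.ofReal (a * b) ^ (-(2 * s)) := by
      have : ‖(((a * b)⁻¹ ^ 2 : ℝ) : ℂ)‖ₑ = ENNReal.ofReal ((a * b)⁻¹ ^ 2) := by
        rw [← ofReal_norm_eq_enorm, Complex.norm_real, Real.norm_of_nonneg (by positivity)]
      rw [this, ENNReal.ofReal_pow (by positivity), ENNReal.ofReal_inv_of_pos hab, ← ENNReal.rpow_natCast, ← ENNReal.rpow_mul,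
        ENNReal.inv_rpow, ENNReal.rpow_neg]
      norm_num
    rw [hc, lintegral_const_mul' _ _ (ENNReal.rpow_ne_top_of_ne_zero hN0 ENNReal.ofReal_ne_top)]
    have he := sd_emb (inv_pos.2 hab) (inv_pos.2 ha) (inv_pos.2 hb)
    have := he.lintegral_map (μ := volume) (fun p => ‖bex (E ×ˢ E ∩ Wset) p‖ₑ ^ s)
    rw [sd_map (inv_pos.2 hab) (inv_pos.2 ha) (inv_pos.2 hb), lintegral_smul_measure] at this
    rw [← this, smul_eq_mul, ← mul_assoc]
    congr 1
    have h2 : ((a * b)⁻¹ * (a⁻¹ * b⁻¹))⁻¹ = (a * b) ^ 2 := by field_simp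
    rw [h2, ENNReal.ofReal_pow hab.le, ← ENNReal.rpow_natCast, ← ENNReal.rpow_add _ _ hN0 ENNReal.ofReal_ne_top]
    congr 1; push_cast; ring
  rw [key]
  calc _ ≤ ENNReal.ofReal (a * b) ^ (2 - 2 * s) * (C * ((ENNReal.ofReal (a * b) * M) ^ (2 * (s / max r 2) - 1) * (ENNReal.ofReal (a * b) * volume Ω))) := by gcongr
    _ = _ := by ring

lemma floor_half (x : ℝ) (i : ℕ) : ⌊2 ^ (i + 1) * x⌋ / 2 = ⌊2 ^ i * x⌋ := by
  have h := Int.floor_div_natCast (2 ^ (i + 1) * x) 2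
  have h2 : (2 : ℝ) ^ (i + 1) * x / (2 : ℕ) = 2 ^ i * x := by push_cast; rw [pow_succ]; ring
  rw [h2] at h
  rw [h]; rfl

/-- separation at scale -/
def sepQ (j : ℕ) (x y : ℝ) : Prop := 2 ≤ |⌊2 ^ j * x⌋ - ⌊2 ^ j * y⌋|

lemma rel_sepQ (i : ℕ) (x y : ℝ) : rel ⌊2 ^ (i + 1) * x⌋ ⌊2 ^ (i + 1) * y⌋ ↔ sepQ (i + 1) x y ∧ ¬ sepQ i x y := by
  rw [rel, sepQ, sepQ, floor_half, floor_half, not_le]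
  constructor <;> rintro ⟨h1, h2⟩ <;> refine ⟨h1, ?_⟩ <;> omega

lemma sepQ_succ (i : ℕ) (x y : ℝ) (h : sepQ i x y) : sepQ (i + 1) x y := by
  have h1 := floor_half x i
  have h2 := floor_half y i
  rw [sepQ, le_abs] at h
  rw [sepQ, le_abs]
  omega

lemma sepQ_mono {i j : ℕ} (hij : i ≤ j) (x y : ℝ) (h : sepQ i x y) : sepQ j x y := by
  induction hij with
  | refl => exact h
  | step _ ih => exact sepQ_succ _ _ _ ih

lemma sepQ_zero (x y : ℝ) (hx : x ∈ Icc (0:ℝ) 1) (hy : y ∈ Icc (0:ℝ) 1) : ¬ sepQ 0 x y := by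
  rw [sepQ, not_le, pow_zero, one_mul, one_mul]
  have h : ∀ z : ℝ, z ∈ Icc (0:ℝ) 1 → 0 ≤ ⌊z⌋ ∧ ⌊z⌋ ≤ 1 := by
    intro z hz
    refine ⟨Int.floor_nonneg.2 hz.1, ?_⟩
    have := Int.floor_mono hz.2
    simpa using this
  have h1 := h x hx
  have h2 := h y hy
  rw [abs_lt]; omega

lemma sepQ_ex (x y : ℝ) (h : x ≠ y) : ∃ j, sepQ j x y := by
  have hp : 0 < |x - y| := abs_pos.2 (sub_ne_zero.2 h)
  obtain ⟨j, hj⟩ := pow_unbounded_of_one_lt (3 / |x - y|) (one_lt_two (α := ℝ))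
  refine ⟨j, ?_⟩
  rw [div_lt_iff₀ hp] at hj
  by_contra hn
  rw [sepQ, not_le] at hn
  have hn' : |⌊2 ^ j * x⌋ - ⌊2 ^ j * y⌋| ≤ 1 := by omega
  have hn2 : |((⌊2 ^ j * x⌋ : ℝ)) - (⌊2 ^ j * y⌋ : ℝ)| ≤ 1 := by exact_mod_cast hn'
  have e : (2:ℝ) ^ j * |x - y| = |2 ^ j * x - 2 ^ j * y| := by
    rw [← mul_sub, abs_mul, abs_of_pos (by positivity : (0:ℝ) < 2 ^ j)]
  rw [e] at hj
  have a1 := Int.floor_le (2 ^ j * x)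
  have a2 := Int.lt_floor_add_one (2 ^ j * x)
  have a3 := Int.floor_le (2 ^ j * y)
  have a4 := Int.lt_floor_add_one (2 ^ j * y)
  rw [abs_le] at hn2
  rw [lt_abs] at hj
  rcases hj with hj | hj <;> linarith [hn2.1, hn2.2]

lemma rel_ex (x y : ℝ) (hx : x ∈ Icc (0:ℝ) 1) (hy : y ∈ Icc (0:ℝ) 1) (h : x ≠ y) : 
    ∃ i : ℕ, rel ⌊2 ^ (i + 1) * x⌋ ⌊2 ^ (i + 1) * y⌋ := by
  classical
  have hex := sepQ_ex x y h
  have h0 : Nat.find hex ≠ 0 := by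
    intro h0
    have := Nat.find_spec hex
    rw [h0] at this
    exact sepQ_zero x y hx hy this
  obtain ⟨i, hi⟩ := Nat.exists_eq_succ_of_ne_zero h0
  refine ⟨i, (rel_sepQ i x y).2 ⟨?_, Nat.find_min hex (by omega)⟩⟩
  have := Nat.find_spec hex
  rwa [hi] at this

lemma rel_uniq {i i' : ℕ} {x y : ℝ} (h : rel ⌊2 ^ (i + 1) * x⌋ ⌊2 ^ (i + 1) * y⌋) 
    (h' : rel ⌊2 ^ (i' + 1) * x⌋ ⌊2 ^ (i' + 1) * y⌋) : i = i' := by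
  rw [rel_sepQ] at h h'
  rcases lt_trichotomy i i' with hl | hl | hl
  · exact absurd (sepQ_mono hl _ _ h.1) h'.2
  · exact hl
  · exact absurd (sepQ_mono hl _ _ h'.1) h.2

/-- Whitney pieces indexed by naturals -/
def Wz (z : ℕ × ℕ) : Set ((ℝ × ℝ) × (ℝ × ℝ)) := Wab (2 ^ (z.1 + 1)) (2 ^ (z.2 + 1))

lemma mem_Wz (z y) : y ∈ Wz z ↔ rel ⌊2 ^ (z.1 + 1) * y.1.1⌋ ⌊2 ^ (z.1 + 1) * y.2.1⌋ ∧ 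
    rel ⌊2 ^ (z.2 + 1) * y.1.2⌋ ⌊2 ^ (z.2 + 1) * y.2.2⌋ := Iff.rfl

lemma Wset_meas : MeasurableSet Wset := by
  have h : ∀ f g : (ℝ × ℝ) × (ℝ × ℝ) → ℝ, Measurable f → Measurable g → MeasurableSet {y | rel ⌊f y⌋ ⌊g y⌋} := by
    intro f g hf hg
    have : Measurable fun y => (⌊f y⌋, ⌊g y⌋) := hf.floor.prodMk hg.floor
    exact this (MeasurableSet.of_discrete (s := {z : ℤ × ℤ | rel z.1 z.2}))
  exact (h _ _ (by fun_prop) (by fun_prop)).inter (h _ _ (by fun_prop) (by fun_prop))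

lemma Wz_meas (z) : MeasurableSet (Wz z) := by
  have h := (sc_emb (a := 2 ^ (z.1 + 1)) (b := 2 ^ (z.2 + 1)) (by positivity) (by positivity)).measurable
  exact (h.prodMap h) Wset_meas

lemma diag_null (f : ℝ × ℝ → ℝ) (hf : Measurable f) (h0 : ∀ c, volume {ζ : ℝ × ℝ | c = f ζ} = 0) : 
    volume {y : (ℝ × ℝ) × (ℝ × ℝ) | f y.1 = f y.2} = 0 := by
  have hm : MeasurableSet {y : (ℝ × ℝ) × (ℝ × ℝ) | f y.1 = f y.2} := 
    measurableSet_eq_fun (by fun_prop) (by fun_prop)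
  rw [Measure.volume_eq_prod, Measure.measure_prod_null hm]
  exact Filter.Eventually.of_forall fun ξ => h0 (f ξ)

lemma bex_hasSum (Ω : Set (ℝ × ℝ)) (hΩ : MeasurableSet Ω) (hΩs : Ω ⊆ Icc 0 1 ×ˢ Icc 0 1) (hf : volume Ω ≠ ∞) (p) :
    HasSum (fun z => bex (Ω ×ˢ Ω ∩ Wz z) p) (ex Ω p ^ 2) := by
  rw [pow_two, ← bex_prod]
  have hae : (Ω ×ˢ Ω : Set _) =ᵐ[volume] ⋃ z, Ω ×ˢ Ω ∩ Wz z := by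
    have n1 := diag_null Prod.fst measurable_fst (by
      intro c
      have : {ζ : ℝ × ℝ | c = ζ.1} = {c} ×ˢ univ := by ext ζ; simp [eq_comm]
      rw [this, Measure.volume_eq_prod, Measure.prod_prod]; simp)
    have n2 := diag_null Prod.snd measurable_snd (by
      intro c
      have : {ζ : ℝ × ℝ | c = ζ.2} = univ ×ˢ {c} := by ext ζ; simp [eq_comm]
      rw [this, Measure.volume_eq_prod, Measure.prod_prod]; simp)
    rw [measure_eq_zero_iff_ae_notMem] at n1 n2
    filter_upwards [n1, n2] with y h1 h2
    apply propext
    change y ∈ Ω ×ˢ Ω ↔ y ∈ ⋃ z, Ω ×ˢ Ω ∩ Wz z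
    rw [← inter_iUnion]
    refine ⟨fun h => ⟨h, ?_⟩, fun h => h.1⟩
    have a1 := hΩs h.1
    have a2 := hΩs h.2
    obtain ⟨i, hi⟩ := rel_ex y.1.1 y.2.1 a1.1 a2.1 h1
    obtain ⟨l, hl⟩ := rel_ex y.1.2 y.2.2 a1.2 a2.2 h2
    exact mem_iUnion.2 ⟨(i, l), (mem_Wz _ _).2 ⟨hi, hl⟩⟩
  have h_integ : IntegrableOn (fun y : (ℝ × ℝ) × (ℝ × ℝ) => ph p y.1 * ph p y.2) (Ω ×ˢ Ω) := by
    have := (ph_integrable p _ hf).mul_prod (ph_integrable p _ hf)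
    rwa [Measure.prod_restrict] at this
  have := hasSum_integral_iUnion (μ := volume) (f := fun y : (ℝ × ℝ) × (ℝ × ℝ) => ph p y.1 * ph p y.2) 
    (s := fun z => Ω ×ˢ Ω ∩ Wz z) (fun z => (hΩ.prod hΩ).inter (Wz_meas z)) (by
      intro z w hzw
      rw [Function.onFun, Set.disjoint_left]
      rintro y ⟨-, h1⟩ ⟨-, h2⟩
      rw [mem_Wz] at h1 h2
      exact hzw (Prod.ext (rel_uniq h1.1 h2.1) (rel_uniq h1.2 h2.2))) 
    (h_integ.mono_set (iUnion_subset fun z => inter_subset_left))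
  rw [← setIntegral_congr_set hae] at this
  exact this

lemma bex_cont (V : Set ((ℝ × ℝ) × (ℝ × ℝ))) (hV : volume V ≠ ∞) : Continuous (bex V) := by
  have : IsFiniteMeasure (volume.restrict V) := ⟨by simpa using hV.lt_top⟩
  refine continuous_of_dominated (bound := fun _ => 1) ?_ ?_ (integrable_const _) ?_
  · intro p
    have := ph_cont' p
    exact (by fun_prop : Continuous fun y : (ℝ × ℝ) × (ℝ × ℝ) => ph p y.1 * ph p y.2).aestronglyMeasurable
  · intro p; exact Filter.Eventually.of_forall fun y => by rw [norm_mul, ph_norm, ph_norm, one_mul]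
  · refine Filter.Eventually.of_forall fun y => ?_
    have := ph_cont
    exact (this.comp (by fun_prop : Continuous fun p => (p, y.1))).mul (this.comp (by fun_prop : Continuous fun p => (p, y.2)))

lemma whitney_bound (s : ℝ) (hs : 1 ≤ s) (Ω : Set (ℝ × ℝ)) (hΩ : MeasurableSet Ω) (hΩs : Ω ⊆ Icc 0 1 ×ˢ Icc 0 1) :
    eLpNorm (ex Ω) (ENNReal.ofReal (2 * s)) volume ^ (2 : ℝ) ≤ 
      ∑' z : ℕ × ℕ, (∫⁻ p, ‖bex (Ω ×ˢ Ω ∩ Wz z) p‖ₑ ^ s) ^ (1 / s) := by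
  have hf : volume Ω ≠ ∞ := by
    have := unitSq_finite 0 0
    simp only [unitSq, zero_add] at this
    exact ne_top_of_le_ne_top (by rw [this]; simp) (measure_mono hΩs)
  have hs0 : 0 < s := by linarith
  have hc : ∀ z, Continuous (bex (Ω ×ˢ Ω ∩ Wz z)) := by
    intro z
    refine bex_cont _ (ne_top_of_le_ne_top ?_ (measure_mono inter_subset_left))
    rw [Measure.volume_eq_prod, Measure.prod_prod]
    exact ENNReal.mul_ne_top hf hf
  have h1 : eLpNorm (ex Ω) (ENNReal.ofReal (2 * s)) volume ^ (2 : ℝ) = eLpNorm (fun p => ex Ω p ^ 2) (ENNReal.ofReal s) volume := by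
    rw [eLpNorm_eq_lintegral_rpow_enorm_toReal (by simpa using hs0) ENNReal.ofReal_ne_top, 
      eLpNorm_eq_lintegral_rpow_enorm_toReal (by simpa using hs0) ENNReal.ofReal_ne_top, 
      ENNReal.toReal_ofReal hs0.le, ENNReal.toReal_ofReal (by positivity), ← ENNReal.rpow_mul]
    congr 1
    · congr 1; ext p
      rw [enorm_pow, ← ENNReal.rpow_natCast, ← ENNReal.rpow_mul]; norm_num
    · field_simp
  have h2 : ∀ z, (∫⁻ p, ‖bex (Ω ×ˢ Ω ∩ Wz z) p‖ₑ ^ s) ^ (1 / s) = eLpNorm (bex (Ω ×ˢ Ω ∩ Wz z)) (ENNReal.ofReal s) volume := by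
    intro z
    rw [eLpNorm_eq_lintegral_rpow_enorm_toReal (by simpa using hs0) ENNReal.ofReal_ne_top, ENNReal.toReal_ofReal hs0.le]
  simp_rw [h1, h2]
  let e : ℕ ≃ ℕ × ℕ := Nat.pairEquiv.symm
  have hlim : ∀ p, Filter.Tendsto (fun n => ∑ i ∈ Finset.range n, bex (Ω ×ˢ Ω ∩ Wz (e i)) p) Filter.atTop (nhds (ex Ω p ^ 2)) := by
    intro p
    have := (bex_hasSum Ω hΩ hΩs hf p)
    rw [← e.hasSum_iff] at this
    exact this.tendsto_sum_nat
  have hl := Lp.eLpNorm_lim_le_liminf_eLpNorm (μ := volume) (p := ENNReal.ofReal s) 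
    (f := fun n p => ∑ i ∈ Finset.range n, bex (Ω ×ˢ Ω ∩ Wz (e i)) p) (fun n => by
      have := fun i => hc (e i)
      exact (by fun_prop : Continuous _).aestronglyMeasurable) (fun p => ex Ω p ^ 2) (Filter.Eventually.of_forall hlim)
  refine hl.trans ?_
  refine Filter.liminf_le_of_le (by isBoundedDefault) ?_
  intro b hb
  obtain ⟨n, hn⟩ := hb.exists
  refine hn.trans ?_
  have hsum := eLpNorm_sum_le (μ := volume) (p := ENNReal.ofReal s) (s := Finset.range n) (f := fun i => bex (Ω ×ˢ Ω ∩ Wz (e i))) 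
    (fun i _ => (hc (e i)).aestronglyMeasurable) (by simpa using hs)
  have heq : (fun p => ∑ i ∈ Finset.range n, bex (Ω ×ˢ Ω ∩ Wz (e i)) p) = ∑ i ∈ Finset.range n, bex (Ω ×ˢ Ω ∩ Wz (e i)) := by
    ext p; simp
  rw [heq]
  refine hsum.trans ?_
  rw [← e.tsum_eq (fun z => eLpNorm (bex (Ω ×ˢ Ω ∩ Wz z)) (ENNReal.ofReal s) volume)]
  exact ENNReal.sum_le_tsum _

lemma fib_bound (B : Set (ℝ × ℝ)) (hB : MeasurableSet B) (X : Set ℝ) (hX : Prod.fst '' B ⊆ X) (c : ℝ≥0∞)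
    (hc : ∀ x, volume (vFiber B x) ≤ c) : volume B ≤ volume X * c := by
  rw [Measure.volume_eq_prod, Measure.prod_apply hB]
  calc ∫⁻ x, volume (Prod.mk x ⁻¹' B) ≤ ∫⁻ x, (toMeasurable volume X).indicator (fun _ => c) x := by
        refine lintegral_mono fun x => ?_
        by_cases hx : x ∈ toMeasurable volume X
        · rw [indicator_of_mem hx]; exact hc x
        · have : Prod.mk x ⁻¹' B = ∅ := by
            rw [eq_empty_iff_forall_notMem]
            intro y hy
            exact hx (subset_toMeasurable _ _ (hX ⟨_, hy, rfl⟩))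
          rw [this]; simp
    _ = volume X * c := by
        rw [lintegral_indicator (measurableSet_toMeasurable _ _), lintegral_const, Measure.restrict_apply_univ, measure_toMeasurable, mul_comm]

lemma fib_lower (B : Set (ℝ × ℝ)) (hB : MeasurableSet B) (c : ℝ≥0∞)
    (hc : ∀ x, (vFiber B x).Nonempty → c ≤ volume (vFiber B x)) : volume (Prod.fst '' B) * c ≤ volume B := by
  rw [Measure.volume_eq_prod, Measure.prod_apply hB]
  have hm : MeasurableSet {x | c ≤ volume (Prod.mk x ⁻¹' B)} := measurableSet_le measurable_const (measurable_measure_prodMk_left hB)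
  calc volume (Prod.fst '' B) * c ≤ volume {x | c ≤ volume (Prod.mk x ⁻¹' B)} * c := by
        gcongr
        rintro x ⟨⟨x, y⟩, h, rfl⟩
        exact hc x ⟨y, h⟩
    _ ≤ _ := by rw [mul_comm]; exact mul_meas_ge_le_lintegral (measurable_measure_prodMk_left hB) c

lemma floor_dyadic (j : ℕ) (m : ℤ) (x : ℝ) (h : ⌊2 ^ j * x⌋ = m) : x ∈ dyadicIcc j m := by
  rw [Int.floor_eq_iff] at h
  have hp : (0:ℝ) < 2 ^ j := by positivity
  rw [dyadicIcc, mem_Icc, zpow_neg, zpow_natCast, mul_inv_le_iff₀ hp, le_mul_inv_iff₀ hp]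
  constructor <;> linarith [h.1, h.2]

lemma vol_dyadic (n m : ℤ) : volume (dyadicIcc n m) = ENNReal.ofReal (2 ^ (-n)) := by
  rw [dyadicIcc, Real.volume_Icc]; congr 1; ring

/-- two-sided decaying profile -/
noncomputable def gg (e b y : ℝ) : ℝ := min (y ^ e) (y ^ (-b))

lemma gg_sum (e b : ℝ) (he : 0 < e) (hb : 0 < b) : 
    ∃ G : ℝ≥0∞, G ≠ ∞ ∧ ∀ α : ℝ, 0 < α → ∑' j : ℕ, ENNReal.ofReal (gg e b (2 ^ j * α)) ≤ G := by
  set c := min e b with hc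
  have hc0 : 0 < c := lt_min he hb
  set q : ℝ := 2 ^ (-c) with hq
  have hq0 : 0 < q := by positivity
  have hq1 : q < 1 := Real.rpow_lt_one_of_one_lt_of_neg one_lt_two (by linarith)
  have hsumm : Summable fun n : ℤ => 2 ^ e * q ^ n.natAbs := by
    refine Summable.mul_left _ ?_
    refine Summable.of_nat_of_neg ?_ ?_
    · simpa using summable_geometric_of_lt_one hq0.le hq1
    · simpa using summable_geometric_of_lt_one hq0.le hq1
  refine ⟨∑' n : ℤ, ENNReal.ofReal (2 ^ e * q ^ n.natAbs), hsumm.tsum_ofReal_ne_top, ?_⟩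
  intro α hα
  obtain ⟨n0, h1, h2⟩ := exists_mem_Ico_zpow hα (one_lt_two (α := ℝ))
  have hinj : Function.Injective fun j : ℕ => (j : ℤ) + n0 := by intro a b h; simpa using h
  refine le_trans ?_ (ENNReal.tsum_comp_le_tsum_of_injective hinj _)
  refine ENNReal.tsum_le_tsum fun j => ENNReal.ofReal_le_ofReal ?_
  have hp : (0:ℝ) < 2 ^ j := by positivity
  have l1 : (2:ℝ) ^ (((j : ℤ) + n0 : ℤ) : ℝ) ≤ 2 ^ j * α := by
    rw [Real.rpow_intCast, zpow_add₀ two_ne_zero, zpow_natCast]; gcongr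
  have l2 : 2 ^ j * α ≤ (2:ℝ) ^ ((((j : ℤ) + n0 : ℤ) : ℝ) + 1) := by
    rw [Real.rpow_add two_pos, Real.rpow_intCast, zpow_add₀ two_ne_zero, zpow_natCast, Real.rpow_one, mul_assoc]
    rw [zpow_add₀ two_ne_zero, zpow_one] at h2
    gcongr
  generalize (j : ℤ) + n0 = n at *
  have hpos : 0 < 2 ^ j * α := by positivity
  have h2e : 1 ≤ (2:ℝ) ^ e := Real.one_le_rpow one_le_two he.le
  have hqn : q ^ n.natAbs = 2 ^ (-c * (n.natAbs : ℝ)) := by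
    rw [hq, ← Real.rpow_natCast, ← Real.rpow_mul two_pos.le]
  rcases le_total 0 n with hn | hn
  · refine (min_le_right _ _).trans ?_
    have : (n.natAbs : ℝ) = (n : ℝ) := by
      rw [Nat.cast_natAbs, abs_of_nonneg hn]
    rw [hqn, this]
    have hn' : (0:ℝ) ≤ n := by exact_mod_cast hn
    calc (2 ^ j * α) ^ (-b) ≤ ((2:ℝ) ^ (n : ℝ)) ^ (-b) := Real.rpow_le_rpow_of_nonpos (by positivity) l1 (by linarith)
      _ = 2 ^ (-b * n) := by rw [← Real.rpow_mul two_pos.le]; congr 1; ring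
      _ ≤ 2 ^ (-c * n) := by
        apply Real.rpow_le_rpow_of_exponent_le one_le_two
        have : c ≤ b := min_le_right _ _
        nlinarith
      _ ≤ 2 ^ e * 2 ^ (-c * n) := le_mul_of_one_le_left (by positivity) h2e
  · refine (min_le_left _ _).trans ?_
    have : (n.natAbs : ℝ) = -(n : ℝ) := by
      rw [Nat.cast_natAbs, abs_of_nonpos hn]; push_cast; ring
    rw [hqn, this]
    have hn' : (n:ℝ) ≤ 0 := by exact_mod_cast hn
    calc (2 ^ j * α) ^ e ≤ ((2:ℝ) ^ ((n : ℝ) + 1)) ^ e := Real.rpow_le_rpow hpos.le l2 he.le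
      _ = 2 ^ e * 2 ^ (e * n) := by rw [← Real.rpow_mul two_pos.le, ← Real.rpow_add two_pos]; congr 1; ring
      _ ≤ 2 ^ e * 2 ^ (-c * -n) := by
        refine mul_le_mul_of_nonneg_left ?_ (by positivity)
        apply Real.rpow_le_rpow_of_exponent_le one_le_two
        have : c ≤ e := min_le_left _ _
        nlinarith

/-- bound of a scale term -/
lemma term_bound (a b e u δ lam σ : ℝ) (ha : 0 ≤ a) (he : 0 < e) (hb : 0 < b) (hab : e = a - b) (hu : 0 < u) (hδ : 0 < δ) (hl : 0 < lam)
    (hl1 : lam ≤ 1) (hσ0 : 0 ≤ σ) (h1 : σ ≤ 2 * δ) (h2 : σ ≤ u⁻¹) (h3 : lam * δ ≤ u⁻¹ → σ ≤ lam * u⁻¹) : 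
    u ^ e * σ ^ a ≤ 2 ^ a * δ ^ b * lam ^ min e b * (gg e b (u * (δ / lam)) + gg e b (u * (δ * lam))) := by
  have hg : ∀ y, 0 ≤ y → 0 ≤ gg e b y := fun y hy => le_min (Real.rpow_nonneg hy _) (Real.rpow_nonneg hy _)
  have hle : lam ^ e ≤ lam ^ min e b := Real.rpow_le_rpow_of_exponent_ge hl hl1 (min_le_left _ _)
  have hlb : lam ^ b ≤ lam ^ min e b := Real.rpow_le_rpow_of_exponent_ge hl hl1 (min_le_right _ _)
  have h2a : 1 ≤ (2:ℝ) ^ a := Real.one_le_rpow one_le_two ha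
  have g1 := hg (u * (δ / lam)) (by positivity)
  have g2 := hg (u * (δ * lam)) (by positivity)
  by_cases h : lam * δ ≤ u⁻¹
  · have h3 := h3 h
    have key : u ^ e * σ ^ a ≤ 2 ^ a * δ ^ b * lam ^ e * gg e b (u * (δ / lam)) := by
      rw [gg, mul_min_of_nonneg _ _ (by positivity)]
      refine le_min ?_ ?_
      · calc u ^ e * σ ^ a ≤ u ^ e * (2 * δ) ^ a := by gcongr
          _ = _ := by
            have : a = e + b := by linarith
            rw [Real.mul_rpow two_pos.le hδ.le, Real.mul_rpow hu.le (by positivity), Real.div_rpow hδ.le hl.le, this, 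
              Real.rpow_add hδ]
            field_simp
      · calc u ^ e * σ ^ a ≤ 1 * (u ^ e * (lam * u⁻¹) ^ a) := by rw [one_mul]; gcongr
          _ ≤ 2 ^ a * (u ^ e * (lam * u⁻¹) ^ a) := by gcongr
          _ = _ := by
            have : a = e + b := by linarith
            rw [Real.mul_rpow hl.le (by positivity), Real.mul_rpow hu.le (by positivity), Real.div_rpow hδ.le hl.le, this, 
              Real.inv_rpow hu.le, Real.rpow_add hl, Real.rpow_add hu, Real.rpow_neg hu.le, Real.rpow_neg hl.le, Real.rpow_neg hδ.le]
            field_simp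
    calc _ ≤ _ := key
      _ ≤ 2 ^ a * δ ^ b * lam ^ min e b * gg e b (u * (δ / lam)) := by gcongr
      _ ≤ _ := by gcongr; linarith
  · have key : u ^ e * σ ^ a ≤ 2 ^ a * δ ^ b * lam ^ b * gg e b (u * (δ * lam)) := by
      have hx : 1 ≤ u * (δ * lam) := by
        rw [not_le, inv_lt_iff_one_lt_mul₀ hu] at h; linarith
      have : gg e b (u * (δ * lam)) = (u * (δ * lam)) ^ (-b) := by
        rw [gg, min_eq_right]
        exact Real.rpow_le_rpow_of_exponent_le hx (by linarith)
      rw [this]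
      calc u ^ e * σ ^ a ≤ 1 * (u ^ e * (u⁻¹) ^ a) := by rw [one_mul]; gcongr
          _ ≤ 2 ^ a * (u ^ e * (u⁻¹) ^ a) := by gcongr
          _ = _ := by
            have : a = e + b := by linarith
            rw [Real.mul_rpow hu.le (by positivity), Real.mul_rpow hδ.le hl.le, this, 
              Real.inv_rpow hu.le, Real.rpow_add hu, Real.rpow_neg hu.le, Real.rpow_neg hl.le, Real.rpow_neg hδ.le]
            field_simp
    calc _ ≤ _ := key
      _ ≤ 2 ^ a * δ ^ b * lam ^ min e b * gg e b (u * (δ * lam)) := by gcongr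
      _ ≤ _ := by gcongr; linarith

lemma two_zpow' (n : ℤ) : (2 : ℝ≥0∞) ^ n = ENNReal.ofReal (2 ^ n) := by
  have h := ENNReal.rpow_intCast 2 n
  have h2 := Real.rpow_intCast 2 n
  rw [← h, ← h2, ← ENNReal.ofReal_rpow_of_pos two_pos]
  norm_num

/-- horizontal measure bound -/
noncomputable def sg (lam δ u : ℝ) : ℝ := min (2 * δ) (if lam * δ ≤ u⁻¹ then lam * u⁻¹ else u⁻¹)

lemma sg_pos {lam δ u : ℝ} (hl : 0 < lam) (hδ : 0 < δ) (hu : 0 < u) : 0 < sg lam δ u := by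
  refine lt_min (by positivity) ?_
  split_ifs <;> positivity

lemma sg_le1 (lam δ u : ℝ) : sg lam δ u ≤ 2 * δ := min_le_left _ _

lemma sg_le2 {lam δ u : ℝ} (hl : lam ≤ 1) (hu : 0 < u) : sg lam δ u ≤ u⁻¹ := by
  refine (min_le_right _ _).trans ?_
  have := inv_pos.2 hu
  split_ifs
  · nlinarith
  · exact le_rfl

lemma sg_le3 {lam δ u : ℝ} (h : lam * δ ≤ u⁻¹) : sg lam δ u ≤ lam * u⁻¹ := by
  refine (min_le_right _ _).trans ?_
  rw [if_pos h]

lemma sg_term (a b e δ lam : ℝ) (ha : 0 ≤ a) (he : 0 < e) (hb : 0 < b) (hab : e = a - b) (hδ : 0 < δ) (hl : 0 < lam)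
    (hl1 : lam ≤ 1) (G : ℝ≥0∞) (hG : ∀ α : ℝ, 0 < α → ∑' j : ℕ, ENNReal.ofReal (gg e b (2 ^ j * α)) ≤ G) :
    ∑' i : ℕ, ENNReal.ofReal ((2 ^ (i + 1)) ^ e * sg lam δ (2 ^ (i + 1)) ^ a) ≤ 
      ENNReal.ofReal (2 ^ a * δ ^ b * lam ^ min e b) * (G + G) := by
  have hg : ∀ y, 0 ≤ y → 0 ≤ gg e b y := fun y hy => le_min (Real.rpow_nonneg hy _) (Real.rpow_nonneg hy _)
  calc _ ≤ ∑' i : ℕ, ENNReal.ofReal (2 ^ a * δ ^ b * lam ^ min e b) * 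
        (ENNReal.ofReal (gg e b (2 ^ i * (2 * (δ / lam)))) + ENNReal.ofReal (gg e b (2 ^ i * (2 * (δ * lam))))) := by
        refine ENNReal.tsum_le_tsum fun i => ?_
        rw [← ENNReal.ofReal_add (hg _ (by positivity)) (hg _ (by positivity)), ← ENNReal.ofReal_mul (by positivity)]
        refine ENNReal.ofReal_le_ofReal ?_
        have hu : (0:ℝ) < 2 ^ (i + 1) := by positivity
        have := term_bound a b e (2 ^ (i + 1)) δ lam (sg lam δ (2 ^ (i + 1))) ha he hb hab hu hδ hl hl1 
          (sg_pos hl hδ hu).le (sg_le1 _ _ _) (sg_le2 hl1 hu) sg_le3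
        have e1 : (2:ℝ) ^ (i + 1) * (δ / lam) = 2 ^ i * (2 * (δ / lam)) := by rw [pow_succ]; ring
        have e2 : (2:ℝ) ^ (i + 1) * (δ * lam) = 2 ^ i * (2 * (δ * lam)) := by rw [pow_succ]; ring
        rwa [e1, e2] at this
    _ ≤ _ := by
        rw [ENNReal.tsum_mul_left, ENNReal.tsum_add]
        gcongr
        · exact hG _ (by positivity)
        · exact hG _ (by positivity)

lemma tile_bound (Ω Ω' : Set (ℝ × ℝ)) (K J : ℕ) (lam : ℝ) (hl : 0 < lam) (hl1 : lam ≤ 1) (hΩ' : MeasurableSet Ω') (hsub : Ω' ⊆ Ω)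
    (hfib : ∀ x : ℝ, (vFiber Ω x).Nonempty → volume (vFiber Ω x) ≤ (2 : ℝ≥0∞) ^ (-(K : ℤ) + 1))
    (hJ : volume (Prod.fst '' Ω) ≤ (2 : ℝ≥0∞) ^ (-(J : ℤ) + 1))
    (H : ∀ n m : ℤ, lam * 2 ^ (-(J : ℤ)) ≤ (2:ℝ) ^ (-n) → (dyadicIcc n m ∩ Prod.fst '' Ω').Nonempty → 
      volume (dyadicIcc n m ∩ Prod.fst '' Ω) ≤ ENNReal.ofReal (lam * 2 ^ (-n)))
    (j k : ℕ) (q : ℤ × ℤ) : 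
    volume (Ω' ∩ sc (2 ^ j) (2 ^ k) ⁻¹' HO q) ≤ ENNReal.ofReal (sg lam (2 ^ (-(J : ℤ))) (2 ^ j) * sg 1 (2 ^ (-(K : ℤ))) (2 ^ k)) := by
  set B := Ω' ∩ sc (2 ^ j) (2 ^ k) ⁻¹' HO q with hB
  have hBm : MeasurableSet B := hΩ'.inter ((sc_emb (by positivity) (by positivity)).measurable (HO_meas q))
  rcases B.eq_empty_or_nonempty with h0 | ⟨ξ₀, hξ₀⟩
  · rw [h0]; simp
  have hin : ∀ ξ ∈ B, ξ.1 ∈ dyadicIcc j q.1 ∧ ξ.2 ∈ dyadicIcc k q.2 := by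
    rintro ξ ⟨-, h1, h2⟩
    exact ⟨floor_dyadic _ _ _ h1, floor_dyadic _ _ _ h2⟩
  have hδJ : (0:ℝ) < 2 ^ (-(J : ℤ)) := by positivity
  have hδK : (0:ℝ) < 2 ^ (-(K : ℤ)) := by positivity
  have hz : ∀ N : ℕ, (2 : ℝ≥0∞) ^ (-(N : ℤ) + 1) = ENNReal.ofReal (2 * 2 ^ (-(N : ℤ))) := by
    intro N
    rw [two_zpow', zpow_add₀ two_ne_zero, zpow_one, mul_comm]
  have hinvj : ∀ j : ℕ, ((2:ℝ) ^ j)⁻¹ = 2 ^ (-(j : ℤ)) := by intro j; rw [zpow_neg, zpow_natCast]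
  rw [ENNReal.ofReal_mul (sg_pos hl hδJ (by positivity)).le]
  refine (fib_bound B hBm (dyadicIcc j q.1 ∩ Prod.fst '' Ω) ?_ (ENNReal.ofReal (sg 1 (2 ^ (-(K : ℤ))) (2 ^ k))) ?_).trans ?_
  · rintro x ⟨ξ, hξ, rfl⟩
    exact ⟨(hin ξ hξ).1, ξ, hsub hξ.1, rfl⟩
  · intro x
    rcases (vFiber B x).eq_empty_or_nonempty with h | ⟨y, hy⟩
    · rw [h]; simp
    have hs1 : vFiber B x ⊆ vFiber Ω x := fun y hy => hsub hy.1
    rw [sg, ENNReal.ofReal_min]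
    refine le_min ?_ ?_
    · rw [← hz]
      exact (measure_mono hs1).trans (hfib x ⟨y, hs1 hy⟩)
    · have : (if 1 * (2:ℝ) ^ (-(K : ℤ)) ≤ (2 ^ k)⁻¹ then 1 * ((2:ℝ) ^ k)⁻¹ else (2 ^ k)⁻¹) = (2 ^ k)⁻¹ := by
        split_ifs <;> simp
      rw [this, hinvj, ← vol_dyadic k q.2]
      exact measure_mono fun y hy => (hin (x, y) hy).2
  · gcongr
    rw [sg, ENNReal.ofReal_min]
    refine le_min ?_ ?_
    · rw [← hz]
      exact (measure_mono inter_subset_right).trans hJ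
    · split_ifs with h
      · rw [hinvj] at h ⊢
        exact H j q.1 h ⟨ξ₀.1, (hin _ hξ₀).1, ξ₀, hξ₀.1, rfl⟩
      · rw [hinvj, ← vol_dyadic j q.1]
        exact measure_mono inter_subset_left

lemma expo_calc (C V : ℝ≥0∞) (n m s k e : ℝ) (hn : 0 < n) (hm : 0 < m) (hs : 0 < s) (hk : 0 ≤ k) (he : e = (k + 3 - 2 * s) / s) :
    (C * (ENNReal.ofReal n ^ (2 - 2 * s) * ((ENNReal.ofReal n * ENNReal.ofReal m) ^ k * (ENNReal.ofReal n * V)))) ^ (1 / s) = 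
      C ^ (1 / s) * V ^ (1 / s) * ENNReal.ofReal (n ^ e * m ^ (k / s)) := by
  have h1 : C * (ENNReal.ofReal n ^ (2 - 2 * s) * ((ENNReal.ofReal n * ENNReal.ofReal m) ^ k * (ENNReal.ofReal n * V))) = 
      C * V * ENNReal.ofReal (n ^ (k + 3 - 2 * s) * m ^ k) := by
    rw [ENNReal.mul_rpow_of_nonneg _ _ hk, ENNReal.ofReal_rpow_of_pos hn, ENNReal.ofReal_rpow_of_pos hn, ENNReal.ofReal_rpow_of_pos hm]
    have : n ^ (k + 3 - 2 * s) = n ^ (2 - 2 * s) * n ^ k * n := by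
      rw [← Real.rpow_add hn, ← Real.rpow_add_one hn.ne']; congr 1; ring
    rw [this, ENNReal.ofReal_mul (by positivity), ENNReal.ofReal_mul (by positivity), ENNReal.ofReal_mul (by positivity)]
    ring
  have hs' : 0 ≤ 1 / s := by positivity
  rw [h1, ENNReal.mul_rpow_of_nonneg _ _ hs', ENNReal.mul_rpow_of_nonneg _ _ hs', ENNReal.ofReal_rpow_of_pos (by positivity), 
    Real.mul_rpow (by positivity) (by positivity), ← Real.rpow_mul hn.le, ← Real.rpow_mul hm.le, he]
  congr 3 <;> congr 1 <;> ring

lemma main_prop (s r A : ℝ) (hs₁ : 3 / 2 < s) (hs₂ : s < 2) (hr : r < s / (s - 1)) (hBH : BH s r A) :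
    ∃ c C : ℝ, 0 < c ∧ 0 < C ∧ ∀ (Ω : Set (ℝ × ℝ)) (K J : ℕ), 
      MeasurableSet Ω → Ω ⊆ Icc 0 1 ×ˢ Icc 0 1 →
        (∀ x : ℝ, (vFiber Ω x).Nonempty →
          (2 : ℝ≥0∞) ^ (-(K : ℤ) - 1) ≤ volume (vFiber Ω x) ∧
            volume (vFiber Ω x) ≤ (2 : ℝ≥0∞) ^ (-(K : ℤ) + 1)) →
        (2 : ℝ≥0∞) ^ (-(J : ℤ) - 1) ≤ volume (Prod.fst '' Ω) →
        volume (Prod.fst '' Ω) ≤ (2 : ℝ≥0∞) ^ (-(J : ℤ) + 1) →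
        ∀ (lam : ℝ) (Ω' : Set (ℝ × ℝ)), 0 < lam → lam ≤ 1 → MeasurableSet Ω' → Ω' ⊆ Ω → 
        (∀ n m : ℤ, lam * 2 ^ (-(J : ℤ)) ≤ (2:ℝ) ^ (-n) → (dyadicIcc n m ∩ Prod.fst '' Ω').Nonempty → 
          volume (dyadicIcc n m ∩ Prod.fst '' Ω) ≤ ENNReal.ofReal (lam * 2 ^ (-n))) → 
        eLpNorm (ex Ω') (ENNReal.ofReal (2 * s)) volume ^ (2 : ℝ) ≤ 
          ENNReal.ofReal (C * lam ^ c) * volume Ω ^ (2 * (1 - 1 / s)) := by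
  set ρ := max r 2 with hρ
  have hs0 : 0 < s := by linarith
  have hs1 : 0 < s - 1 := by linarith
  have hρ2 : 2 ≤ ρ := le_max_right _ _
  have hρ0 : 0 < ρ := by linarith
  have hρs : ρ < s / (s - 1) := by
    refine max_lt hr ?_
    rw [lt_div_iff₀ hs1]; linarith
  have hsρ : s - 1 < s / ρ := by
    rw [lt_div_iff₀ hρ0]; rw [lt_div_iff₀ hs1] at hρs; linarith
  set k := 2 * (s / ρ) - 1 with hk
  have hk0 : 0 ≤ k := by linarith
  set a := k / s with ha
  set b := (2 * s - 3) / s with hb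
  set e := (k + 3 - 2 * s) / s with he
  have ha0 : 0 ≤ a := by positivity
  have hb0 : 0 < b := div_pos (by linarith) hs0
  have he0 : 0 < e := div_pos (by linarith) hs0
  have hab : e = a - b := by rw [he, ha, hb]; ring
  obtain ⟨C1, hC1t, hC1⟩ := scaled s r A (by linarith) hs₂.le hBH (by linarith)
  obtain ⟨G, hGt, hG⟩ := gg_sum e b he0 hb0
  set Q : ℝ≥0∞ := C1 ^ (1 / s) * ENNReal.ofReal (2 ^ a) * ENNReal.ofReal (2 ^ a) * 4 ^ b * ((G + G) * (G + G)) with hQ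
  have hQt : Q ≠ ∞ := by
    refine ENNReal.mul_ne_top (ENNReal.mul_ne_top (ENNReal.mul_ne_top (ENNReal.mul_ne_top ?_ ENNReal.ofReal_ne_top) ENNReal.ofReal_ne_top) ?_) ?_
    · exact ENNReal.rpow_ne_top_of_nonneg (by positivity) hC1t
    · exact ENNReal.rpow_ne_top_of_nonneg hb0.le (by simp)
    · exact ENNReal.mul_ne_top (by simp [hGt]) (by simp [hGt])
  refine ⟨min e b, Q.toReal + 1, lt_min he0 hb0, by positivity, ?_⟩
  intro Ω K J hΩ hΩs hfib hJ1 hJ2 lam Ω' hl hl1 hΩ' hsub H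
  have hδJ : (0:ℝ) < 2 ^ (-(J : ℤ)) := by positivity
  have hδK : (0:ℝ) < 2 ^ (-(K : ℤ)) := by positivity
  set δJ : ℝ := 2 ^ (-(J : ℤ)) with hδJe
  set δK : ℝ := 2 ^ (-(K : ℤ)) with hδKe
  have hlow : ENNReal.ofReal (δJ * δK) ≤ 4 * volume Ω := by
    have h1 := fib_lower Ω hΩ _ (fun x hx => (hfib x hx).1)
    have hz : ∀ N : ℕ, (2 : ℝ≥0∞) ^ (-(N : ℤ) - 1) * 2 = ENNReal.ofReal (2 ^ (-(N : ℤ))) := by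
      intro N
      rw [two_zpow', zpow_sub₀ two_ne_zero, zpow_one]
      have : (2:ℝ≥0∞) = ENNReal.ofReal 2 := by simp
      rw [this, ← ENNReal.ofReal_mul (by positivity)]
      congr 1; field_simp
    calc ENNReal.ofReal (δJ * δK) = (2 : ℝ≥0∞) ^ (-(J : ℤ) - 1) * 2 * ((2 : ℝ≥0∞) ^ (-(K : ℤ) - 1) * 2) := by
          rw [hz, hz, ENNReal.ofReal_mul hδJ.le]
      _ = 4 * ((2 : ℝ≥0∞) ^ (-(J : ℤ) - 1) * (2 : ℝ≥0∞) ^ (-(K : ℤ) - 1)) := by ring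
      _ ≤ 4 * (volume (Prod.fst '' Ω) * (2 : ℝ≥0∞) ^ (-(K : ℤ) - 1)) := by gcongr
      _ ≤ _ := by gcongr
  let F : ℕ → ℝ≥0∞ := fun i => ENNReal.ofReal ((2 ^ (i + 1)) ^ e * sg lam δJ (2 ^ (i + 1)) ^ a)
  let F' : ℕ → ℝ≥0∞ := fun i => ENNReal.ofReal ((2 ^ (i + 1)) ^ e * sg 1 δK (2 ^ (i + 1)) ^ a)
  have hF : ∑' i, F i ≤ _ := sg_term a b e δJ lam ha0 he0 hb0 hab hδJ hl hl1 G hG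
  have hF' : ∑' i, F' i ≤ _ := sg_term a b e δK 1 ha0 he0 hb0 hab hδK one_pos le_rfl G hG
  have hterm : ∀ z : ℕ × ℕ, (∫⁻ p, ‖bex (Ω' ×ˢ Ω' ∩ Wz z) p‖ₑ ^ s) ^ (1 / s) ≤ C1 ^ (1 / s) * volume Ω ^ (1 / s) * (F z.1 * F' z.2) := by
    intro z
    have hp1 := sg_pos hl hδJ (by positivity : (0:ℝ) < 2 ^ (z.1 + 1))
    have hp2 := sg_pos one_pos hδK (by positivity : (0:ℝ) < 2 ^ (z.2 + 1))
    have h1 := hC1 Ω' (2 ^ (z.1 + 1)) (2 ^ (z.2 + 1)) _ (by positivity) (by positivity) hΩ' (hsub.trans hΩs) 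
      (tile_bound Ω Ω' K J lam hl hl1 hΩ' hsub (fun x hx => (hfib x hx).2) hJ2 H (z.1 + 1) (z.2 + 1))
    refine (ENNReal.rpow_le_rpow h1 (by positivity : 0 ≤ 1 / s)).trans ?_
    rw [expo_calc C1 _ _ _ s k e (by positivity) (by positivity) hs0 hk0 he]
    have hFF : F z.1 * F' z.2 = ENNReal.ofReal ((2 ^ (z.1 + 1) * 2 ^ (z.2 + 1)) ^ e * (sg lam δJ (2 ^ (z.1 + 1)) * sg 1 δK (2 ^ (z.2 + 1))) ^ (k / s)) := by
      simp only [F, F']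
      rw [← ENNReal.ofReal_mul (by positivity), Real.mul_rpow (by positivity) (by positivity), Real.mul_rpow hp1.le hp2.le]
      congr 1; ring
    rw [hFF]
    gcongr
  refine (whitney_bound s (by linarith) Ω' hΩ' (hsub.trans hΩs)).trans ?_
  calc _ ≤ ∑' z : ℕ × ℕ, C1 ^ (1 / s) * volume Ω ^ (1 / s) * (F z.1 * F' z.2) := ENNReal.tsum_le_tsum hterm
    _ = C1 ^ (1 / s) * volume Ω ^ (1 / s) * ((∑' i, F i) * ∑' i, F' i) := by
        rw [ENNReal.tsum_mul_left, ENNReal.tsum_prod']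
        simp_rw [ENNReal.tsum_mul_left, ENNReal.tsum_mul_right]
    _ ≤ C1 ^ (1 / s) * volume Ω ^ (1 / s) * ((ENNReal.ofReal (2 ^ a * δJ ^ b * lam ^ min e b) * (G + G)) * (ENNReal.ofReal (2 ^ a * δK ^ b * 1 ^ min e b) * (G + G))) := by
        gcongr
    _ = C1 ^ (1 / s) * ENNReal.ofReal (2 ^ a) * ENNReal.ofReal (2 ^ a) * ((G + G) * (G + G)) * ENNReal.ofReal (lam ^ min e b) * (volume Ω ^ (1 / s) * ENNReal.ofReal (δJ * δK) ^ b) := by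
        rw [Real.one_rpow, mul_one, ENNReal.ofReal_rpow_of_pos (by positivity), Real.mul_rpow hδJ.le hδK.le, 
          ENNReal.ofReal_mul (by positivity), ENNReal.ofReal_mul (by positivity), ENNReal.ofReal_mul (by positivity), ENNReal.ofReal_mul (by positivity)]
        ring
    _ ≤ C1 ^ (1 / s) * ENNReal.ofReal (2 ^ a) * ENNReal.ofReal (2 ^ a) * ((G + G) * (G + G)) * ENNReal.ofReal (lam ^ min e b) * (volume Ω ^ (1 / s) * (4 * volume Ω) ^ b) := by
        gcongr
    _ = Q * ENNReal.ofReal (lam ^ min e b) * volume Ω ^ (2 * (1 - 1 / s)) := by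
        have : 2 * (1 - 1 / s) = 1 / s + b := by rw [hb]; field_simp; ring
        rw [this, ENNReal.rpow_add_of_nonneg _ _ (by positivity) hb0.le, ENNReal.mul_rpow_of_nonneg _ _ hb0.le]
        ring
    _ ≤ _ := by
        gcongr
        rw [ENNReal.ofReal_mul (by positivity)]
        gcongr
        rw [← ENNReal.ofReal_toReal hQt]
        apply ENNReal.ofReal_le_ofReal
        simp

/-- half-open dyadic cell -/
def cell (J : ℕ) (m : ℤ) : Set ℝ := {x | ⌊2 ^ J * x⌋ = m}

lemma cell_meas (J m) : MeasurableSet (cell J m) := by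
  have h : Measurable fun x : ℝ => ⌊2 ^ J * x⌋ := Int.measurable_floor.comp (by fun_prop)
  exact h (measurableSet_singleton m)

lemma cell_sum (S : Set ℝ) (J : ℕ) (L : Finset ℤ) (i : ℤ) : ∑ m ∈ L, volume (cell J (m + i) ∩ S) ≤ volume S := by
  simp_rw [← Measure.restrict_apply (cell_meas J _)]
  rw [← measure_biUnion_finset]
  · calc _ ≤ volume.restrict S univ := measure_mono (subset_univ _)
      _ = volume S := by simp
  · rintro m - m' - h
    rw [Function.onFun, Set.disjoint_left]
    intro x h1 h2
    apply h
    have a1 : ⌊2 ^ J * x⌋ = m + i := h1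
    have a2 : ⌊2 ^ J * x⌋ = m' + i := h2
    omega
  · intro m _; exact cell_meas _ _

lemma count_lemma (S : Set ℝ) (J : ℕ) (L : Finset ℤ) (N : ℕ) (t : ℝ≥0∞) 
    (h : ∀ m ∈ L, t ≤ ∑ i ∈ Finset.Icc (-(N : ℤ)) N, volume (cell J (m + i) ∩ S)) : 
    L.card * t ≤ (2 * N + 1) * volume S := by
  calc L.card * t = ∑ m ∈ L, t := by rw [Finset.sum_const, nsmul_eq_mul]
    _ ≤ ∑ m ∈ L, ∑ i ∈ Finset.Icc (-(N : ℤ)) N, volume (cell J (m + i) ∩ S) := Finset.sum_le_sum h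
    _ = ∑ i ∈ Finset.Icc (-(N : ℤ)) N, ∑ m ∈ L, volume (cell J (m + i) ∩ S) := Finset.sum_comm
    _ ≤ ∑ i ∈ Finset.Icc (-(N : ℤ)) N, volume S := Finset.sum_le_sum fun i _ => cell_sum S J L i
    _ = _ := by
      rw [Finset.sum_const, nsmul_eq_mul, Int.card_Icc]
      have : ((N : ℤ) + 1 - -(N : ℤ)).toNat = 2 * N + 1 := by omega
      rw [this]; push_cast; rfl

lemma window (S : Set ℝ) (J : ℕ) (n m' m : ℤ) (N : ℕ) (x : ℝ) (hx : x ∈ dyadicIcc n m') (hm : ⌊2 ^ J * x⌋ = m) 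
    (hN : (2:ℝ) ^ (-n) ≤ N * 2 ^ (-(J : ℤ))) : 
    volume (dyadicIcc n m' ∩ S) ≤ ∑ i ∈ Finset.Icc (-(N : ℤ)) N, volume (cell J (m + i) ∩ S) := by
  refine le_trans (measure_mono ?_) (measure_biUnion_finset_le _ _)
  rintro y ⟨hy, hyS⟩
  have hp : (0:ℝ) < 2 ^ J := by positivity
  have hN' : (2:ℝ) ^ J * 2 ^ (-n) ≤ N := by
    rw [zpow_neg _ (J : ℤ), zpow_natCast, ← div_eq_mul_inv, le_div_iff₀ hp] at hN
    linarith
  rw [dyadicIcc, mem_Icc] at hx hy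
  have h1 : 2 ^ J * y ≤ 2 ^ J * x + N := by
    have : y ≤ x + 2 ^ (-n) := by linarith [hx.1, hy.2]
    nlinarith
  have h2 : 2 ^ J * x ≤ 2 ^ J * y + N := by
    have : x ≤ y + 2 ^ (-n) := by linarith [hx.2, hy.1]
    nlinarith
  have h1' := Int.floor_mono h1
  have h2' := Int.floor_mono h2
  rw [Int.floor_add_natCast] at h1' h2'
  refine mem_biUnion (x := ⌊2 ^ J * y⌋ - m) ?_ ⟨?_, hyS⟩
  · simp only [Finset.coe_Icc, mem_Icc]
    omega
  · change ⌊2 ^ J * y⌋ = m + (⌊2 ^ J * y⌋ - m)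
    ring

lemma count_real (c N : ℕ) (t δ : ℝ) (V : ℝ≥0∞) (ht : 0 ≤ t) (hδ : 0 < δ) (hV : V ≤ ENNReal.ofReal (2 * δ)) 
    (h : (c : ℝ≥0∞) * ENNReal.ofReal (t * δ) ≤ (2 * N + 1) * V) : (c : ℝ) * t ≤ (2 * N + 1) * 2 := by
  have h2 : (c : ℝ≥0∞) * ENNReal.ofReal (t * δ) ≤ (2 * N + 1) * ENNReal.ofReal (2 * δ) := h.trans (by gcongr)
  have e1 : (c : ℝ≥0∞) = ENNReal.ofReal c := by simp
  have e2 : (2 * N + 1 : ℝ≥0∞) = ENNReal.ofReal (2 * N + 1) := by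
    have : (2 * N + 1 : ℝ) = ((2 * N + 1 : ℕ) : ℝ) := by push_cast; ring
    rw [this, ENNReal.ofReal_natCast]; push_cast; rfl
  rw [e1, e2, ← ENNReal.ofReal_mul (by positivity), ← ENNReal.ofReal_mul (by positivity), ENNReal.ofReal_le_ofReal_iff (by positivity)] at h2
  have : (c : ℝ) * t * δ ≤ (2 * N + 1) * 2 * δ := by linarith
  exact le_of_mul_le_mul_right this hδ

lemma cover (S : Set ℝ) (J : ℕ) (C η : ℝ) (hη : 0 < η) (hS01 : S ⊆ Icc 0 1) 
    (hvol : volume S ≤ (2 : ℝ≥0∞) ^ (-(J : ℤ) + 1)) : 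
    ∃ T : Finset ℤ, (T.card : ℝ) ≤ 20 * η ^ (-(2 * C)) ∧ Tset S C J η ⊆ ⋃ m ∈ T, dyadicIcc (J : ℤ) m := by
  classical
  set μ := η ^ C with hμ
  have hμ0 : 0 < μ := Real.rpow_pos_of_pos hη C
  have hexp : η ^ (-(2 * C)) = (μ ^ 2)⁻¹ := by
    rw [Real.rpow_neg hη.le, mul_comm, Real.rpow_mul hη.le]; norm_num [hμ]
  rw [hexp]
  set δ : ℝ := 2 ^ (-(J : ℤ)) with hδ
  have hδ0 : 0 < δ := by positivity
  have hvol' : volume S ≤ ENNReal.ofReal (2 * δ) := by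
    rw [two_zpow', zpow_add₀ two_ne_zero, zpow_one, mul_comm] at hvol; exact hvol
  rcases lt_or_ge 1 μ with h1 | h1
  · refine ⟨∅, by simp; positivity, ?_⟩
    rintro x ⟨-, n, m, -, -, h⟩
    exfalso
    have h2 := h.trans (measure_mono inter_subset_left)
    rw [vol_dyadic, ENNReal.ofReal_le_ofReal_iff (by positivity)] at h2
    have : (0:ℝ) < 2 ^ (-n) := by positivity
    nlinarith
  let N : ℕ := ⌊2 / μ⌋₊ + 1
  have hN1 : 2 / μ ≤ N := by simp only [N]; push_cast; exact (Nat.lt_floor_add_one _).le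
  have hN2 : (N : ℝ) ≤ 3 / μ := by
    simp only [N]; push_cast
    have a1 := Nat.floor_le (by positivity : 0 ≤ 2 / μ)
    have a2 : 1 ≤ 1 / μ := by rw [le_div_iff₀ hμ0]; linarith
    have : 3 / μ = 2 / μ + 1 / μ := by ring
    linarith
  let L : Finset ℤ := (Finset.Icc 0 (2 ^ J)).filter fun m => ∃ x ∈ Tset S C J η, ⌊2 ^ J * x⌋ = m
  let L1 := L.filter fun m => ENNReal.ofReal (μ ^ 2 * δ) ≤ ∑ i ∈ Finset.Icc (-((1 : ℕ) : ℤ)) (1 : ℕ), volume (cell J (m + i) ∩ S)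
  let L2 := L.filter fun m => ENNReal.ofReal (μ * δ) ≤ ∑ i ∈ Finset.Icc (-(N : ℤ)) N, volume (cell J (m + i) ∩ S)
  have c1 := count_real L1.card 1 (μ ^ 2) δ _ (by positivity) hδ0 hvol' (count_lemma S J L1 1 _ (fun m hm => (Finset.mem_filter.1 hm).2))
  have c2 := count_real L2.card N μ δ _ hμ0.le hδ0 hvol' (count_lemma S J L2 N _ (fun m hm => (Finset.mem_filter.1 hm).2))
  refine ⟨L1 ∪ L2, ?_, ?_⟩
  · have hc : ((L1 ∪ L2).card : ℝ) ≤ L1.card + L2.card := by exact_mod_cast Finset.card_union_le _ _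
    rw [← div_eq_mul_inv, le_div_iff₀ (by positivity)]
    have hN3 : N * μ ≤ 3 := by rwa [le_div_iff₀ hμ0] at hN2
    have c2' : (L2.card : ℝ) * μ ^ 2 ≤ 14 := by nlinarith
    push_cast at c1
    nlinarith [sq_nonneg μ]
  · intro x hx
    obtain ⟨hxS, n, m', hxI, hI1, hI2⟩ := id hx
    have hfl : ⌊2 ^ J * x⌋ ∈ Finset.Icc (0:ℤ) (2 ^ J) := by
      have h01 := hS01 hxS
      rw [Finset.mem_Icc]
      refine ⟨Int.floor_nonneg.2 (mul_nonneg (by positivity) h01.1), ?_⟩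
      have h3 : 2 ^ J * x ≤ ((2 ^ J : ℤ) : ℝ) := by
        push_cast; exact mul_le_of_le_one_right (by positivity) h01.2
      have := Int.floor_mono h3
      rwa [Int.floor_intCast] at this
    have hL : ⌊2 ^ J * x⌋ ∈ L := Finset.mem_filter.2 ⟨hfl, x, hx, rfl⟩
    refine mem_biUnion (x := ⌊2 ^ J * x⌋) ?_ (floor_dyadic J _ x rfl)
    rw [Finset.mem_coe, Finset.mem_union]
    rcases le_or_gt ((2:ℝ) ^ (-n)) δ with h | h
    · left
      refine Finset.mem_filter.2 ⟨hL, ?_⟩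
      refine le_trans ?_ (hI2.trans (window S J n m' _ 1 x hxI rfl (by rw [Nat.cast_one, one_mul]; exact h)))
      apply ENNReal.ofReal_le_ofReal
      nlinarith
    · right
      refine Finset.mem_filter.2 ⟨hL, ?_⟩
      refine le_trans ?_ (hI2.trans (window S J n m' _ N x hxI rfl ?_))
      · apply ENNReal.ofReal_le_ofReal
        gcongr
      · have h3 := hI2.trans ((measure_mono inter_subset_right).trans hvol')
        rw [ENNReal.ofReal_le_ofReal_iff (by positivity)] at h3
        calc (2:ℝ) ^ (-n) ≤ 2 / μ * δ := by
              rw [div_mul_eq_mul_div, le_div_iff₀ hμ0]; linarith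
          _ ≤ N * δ := by gcongr

lemma sqrt_bound (X V : ℝ≥0∞) (D w : ℝ) (hD : 0 ≤ D) (h : X ^ (2:ℝ) ≤ ENNReal.ofReal (D ^ 2) * V ^ (2 * w)) : 
    X ≤ ENNReal.ofReal D * V ^ w := by
  rw [← ENNReal.rpow_le_rpow_iff (two_pos : (0:ℝ) < 2)]
  refine h.trans (le_of_eq ?_)
  rw [ENNReal.mul_rpow_of_nonneg _ _ two_pos.le, ← ENNReal.rpow_mul, ENNReal.ofReal_pow hD, mul_comm w 2]
  congr 1
  exact_mod_cast (ENNReal.rpow_natCast (ENNReal.ofReal D) 2).symm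

/-- first-stage decomposition: under BH(s,r) with `3/2 < s < 2`, `r < s'`,
there are admissible constants `C₀, C' > 0` such that, with `Ω, K, J, ε` as in the
near-extremizer setup, `C ≥ C₀`, `S = π₁(Ω)`, and the sets `T_η`, `S_η`, `Ω¹_η = Ω ∩ π₁⁻¹(S_η)`
defined as above, for every dyadic `0 < η ≤ ε`:
(i) `S_η` is contained in a union of at most `C'·η^{-2C}` dyadic intervals of length `2^{-J}`;
(ii) if moreover `η < ε`, then for every measurable `Ω' ⊆ Ω¹_η`,
`∥𝓔χ_{Ω'}∥_{L^{2s}} ≤ C'·η²·|Ω|^{1/s'}`. -/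
theorem stmt6 (s r A : ℝ) (hs₁ : 3 / 2 < s) (hs₂ : s < 2) (hr : r < s / (s - 1))
    (hBH : BH s r A) :
    ∃ C₀ C' : ℝ, 0 < C₀ ∧ 0 < C' ∧
      ∀ (Ω : Set (ℝ × ℝ)) (K J : ℕ) (ε C : ℝ), C₀ ≤ C →
        MeasurableSet Ω → Ω ⊆ Icc 0 1 ×ˢ Icc 0 1 →
        (∀ x : ℝ, (vFiber Ω x).Nonempty →
          (2 : ℝ≥0∞) ^ (-(K : ℤ) - 1) ≤ volume (vFiber Ω x) ∧
            volume (vFiber Ω x) ≤ (2 : ℝ≥0∞) ^ (-(K : ℤ) + 1)) →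
        (2 : ℝ≥0∞) ^ (-(J : ℤ) - 1) ≤ volume (Prod.fst '' Ω) →
        volume (Prod.fst '' Ω) ≤ (2 : ℝ≥0∞) ^ (-(J : ℤ) + 1) →
        IsDyadic ε → VargasBound s Ω ε →
        (∀ ε' : ℝ, IsDyadic ε' → ε' < ε → ¬ VargasBound s Ω ε') →
        ∀ η : ℝ, IsDyadic η → 0 < η → η ≤ ε →
          (∃ T : Finset ℤ, (T.card : ℝ) ≤ C' * η ^ (-(2 * C)) ∧
            Sset (Prod.fst '' Ω) C J ε η ⊆ ⋃ m ∈ T, dyadicIcc (J : ℤ) m) ∧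
          (η < ε →
            ∀ Ω' ⊆ Ω ∩ Prod.fst ⁻¹' Sset (Prod.fst '' Ω) C J ε η, MeasurableSet Ω' →
              eLpNorm (extOp (chi Ω')) (ENNReal.ofReal (2 * s)) volume ≤
                ENNReal.ofReal (C' * η ^ 2) * volume Ω ^ (1 - 1 / s)) := by
  obtain ⟨c, D, hc, hD, hmain⟩ := main_prop s r A hs₁ hs₂ hr hBH
  refine ⟨4 / c, 20 + 4 * Real.sqrt D, by positivity, by positivity, ?_⟩
  intro Ω K J ε C hC hΩ hΩs hfib hJ1 hJ2 _ _ _ η hdy hη hηε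
  have hsq : 0 ≤ Real.sqrt D := Real.sqrt_nonneg D
  have hsqD : Real.sqrt D ^ 2 = D := Real.sq_sqrt hD.le
  have hC4 : 4 ≤ C * c := by rwa [div_le_iff₀ hc] at hC
  have hC0 : 0 < C := lt_of_lt_of_le (by positivity) hC
  constructor
  · have hS01 : Prod.fst '' Ω ⊆ Icc (0:ℝ) 1 := by
      rintro x ⟨ξ, hξ, rfl⟩
      exact (hΩs hξ).1
    obtain ⟨T, hT1, hT2⟩ := cover (Prod.fst '' Ω) J C η hη hS01 hJ2
    refine ⟨T, hT1.trans ?_, ?_⟩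
    · have : 0 ≤ η ^ (-(2 * C)) := Real.rpow_nonneg hη.le _
      gcongr
      linarith
    · refine Subset.trans ?_ hT2
      rw [Sset]
      split_ifs
      · exact diff_subset
      · exact Subset.rfl
  · intro hlt Ω' hΩ'sub hΩ'
    rw [extOp_chi Ω' hΩ']
    have hsub : Ω' ⊆ Ω := fun ξ hξ => (hΩ'sub hξ).1
    rcases le_or_gt 1 η with h1 | h1
    · have hm := hmain Ω K J hΩ hΩs hfib hJ1 hJ2 1 Ω' one_pos le_rfl hΩ' hsub (by
        intro n m _ _
        rw [one_mul, ← vol_dyadic n m]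
        exact measure_mono inter_subset_left)
      rw [Real.one_rpow, mul_one, ← hsqD] at hm
      refine (sqrt_bound _ _ _ _ hsq hm).trans ?_
      gcongr
      have : 1 ≤ η ^ 2 := one_le_pow₀ h1
      nlinarith
    · have hη2 : 2 * η ≤ 1 := by
        obtain ⟨n, rfl⟩ := hdy
        have hn : n < 0 := by
          by_contra hn
          exact absurd (one_le_zpow₀ one_le_two (not_lt.1 hn)) (not_le.2 h1)
        have : (2:ℝ) * 2 ^ n = 2 ^ (n + 1) := by rw [zpow_add₀ two_ne_zero, zpow_one, mul_comm]
        rw [this]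
        exact zpow_le_one_of_nonpos₀ one_le_two (by omega)
      have h2η : 0 < 2 * η := by positivity
      have hm := hmain Ω K J hΩ hΩs hfib hJ1 hJ2 ((2 * η) ^ C) Ω' (Real.rpow_pos_of_pos h2η C) 
        (Real.rpow_le_one h2η.le hη2 hC0.le) hΩ' hsub (by
          rintro n m hnm ⟨x, hx, ξ, hξ, rfl⟩
          have h3 := (hΩ'sub hξ).2
          rw [mem_preimage, Sset, if_pos hlt] at h3
          by_contra hcon
          exact h3.2 ⟨⟨ξ, hsub hξ, rfl⟩, n, m, hx, hnm, (not_le.1 hcon).le⟩)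
      have hpow : ((2 * η) ^ C) ^ c ≤ (2 * η) ^ 4 := by
        rw [← Real.rpow_mul h2η.le, ← Real.rpow_natCast]
        exact Real.rpow_le_rpow_of_exponent_ge h2η hη2 (by push_cast; exact hC4)
      have hm2 : eLpNorm (ex Ω') (ENNReal.ofReal (2 * s)) volume ^ (2 : ℝ) ≤ 
          ENNReal.ofReal ((4 * Real.sqrt D * η ^ 2) ^ 2) * volume Ω ^ (2 * (1 - 1 / s)) := by
        refine hm.trans ?_
        gcongr
        calc D * ((2 * η) ^ C) ^ c ≤ D * (2 * η) ^ 4 := by gcongr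
          _ = Real.sqrt D ^ 2 * (2 * η) ^ 4 := by rw [hsqD]
          _ = _ := by ring
      refine (sqrt_bound _ _ _ _ (by positivity) hm2).trans ?_
      gcongr
      linarith
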